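/- arXiv:1706.07653 — 2 statements merged into one kernel-verified Lean document; each statement's English description precedes it below -/
import Mathlib

section
/- As n → ∞ along even integers, one has P^{G2}_{2n}(2,1) · n^{3} · 4^{−n} → 4/π; that is, P^{G2}_{2n}(2,1) is asymptotic to (4/π) · 4^n / n^3. -/
open Finset Filter

attribute [local instance] Classical.propDecidable

/-- Height (second coordinate) of a binomial path after `i` steps, starting at height `c`;
steps are encoded by `s : Fin n → Bool` (`true` = up step `(1,1)`, `false` = down step `(1,-1)`).
The path visits the points `(x₀ + i, hgt c s i)` for `0 ≤ i ≤ n`. -/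
def hgt {n : ℕ} (c : ℤ) (s : Fin n → Bool) (i : ℕ) : ℤ :=
  c + ∑ j ∈ Finset.range i, (if h : j < n then (if s ⟨j, h⟩ then (1 : ℤ) else -1) else 0)

/-- The path lies in the upper half-plane (all second coordinates ≥ 0). -/
def InUHP {n : ℕ} (c : ℤ) (s : Fin n → Bool) : Prop :=
  ∀ i ≤ n, 0 ≤ hgt c s i

/-- The number of vertices of the path with second coordinate 0. -/
def visits {n : ℕ} (c : ℤ) (s : Fin n → Bool) : ℕ :=
  ((Finset.range (n + 1)).filter (fun i => hgt c s i = 0)).card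

/-- `s¹_n(k,m)`: the number of pairs `(σ, τ)` of binomial paths of length `n` in the
upper half-plane, with `σ` from `(0,0)` to `(n,m)`, `τ` from `(0,2)` to `(n,k+2)`, and
the second coordinate of `τᵢ` strictly greater than that of `σᵢ` for all `0 ≤ i ≤ n`. -/
noncomputable def s1Count (n k m : ℕ) : ℕ :=
  ((Finset.univ : Finset ((Fin n → Bool) × (Fin n → Bool))).filter
    (fun p => InUHP 0 p.1 ∧ InUHP 2 p.2 ∧ (∀ i ≤ n, hgt 0 p.1 i < hgt 2 p.2 i) ∧
      hgt 0 p.1 n = (m : ℤ) ∧ hgt 2 p.2 n = (k : ℤ) + 2)).card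

/-- `s_n(k,m)`: the sum, over the same pairs `(σ, τ)` as in `s1Count`, of `a` raised to
the number of vertices of the lower path `σ` with second coordinate `0`. -/
noncomputable def sW (a : ℝ) (n k m : ℕ) : ℝ :=
  ∑ p ∈ (Finset.univ : Finset ((Fin n → Bool) × (Fin n → Bool))).filter
      (fun p => InUHP 0 p.1 ∧ InUHP 2 p.2 ∧ (∀ i ≤ n, hgt 0 p.1 i < hgt 2 p.2 i) ∧
        hgt 0 p.1 n = (m : ℤ) ∧ hgt 2 p.2 n = (k : ℤ) + 2),
    a ^ visits 0 p.1

/-- `P^{G2}_{2n}(a,y) = Σ_{k=0}^{(n-2)/2} Σ_{m=1}^{k} (s_{(n-2)/2}(k,m))² y^{k+2}`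
(for even `n`). -/
noncomputable def PG2 (n : ℕ) (a y : ℝ) : ℝ :=
  ∑ k ∈ Finset.range ((n - 2) / 2 + 1), ∑ m ∈ Finset.Icc 1 k,
    (sW a ((n - 2) / 2) k m) ^ 2 * y ^ (k + 2)

def stp (b : Bool) : ℤ := if b then 1 else -1

abbrev snc {n : ℕ} (s : Fin n → Bool) (b : Bool) : Fin (n+1) → Bool :=
  Fin.snoc (α := fun _ => Bool) s b

lemma hgt_snc {n : ℕ} (c : ℤ) (s : Fin n → Bool) (b : Bool) (i : ℕ) (hi : i ≤ n) :
    hgt c (snc s b) i = hgt c s i := by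
  unfold hgt
  congr 1
  apply Finset.sum_congr rfl
  intro j hj
  have hj' : j < n := lt_of_lt_of_le (Finset.mem_range.1 hj) hi
  rw [dif_pos hj', dif_pos (by omega)]
  simp [snc, Fin.snoc, hj']

lemma hgt_snc_last {n : ℕ} (c : ℤ) (s : Fin n → Bool) (b : Bool) :
    hgt c (snc s b) (n+1) = hgt c s n + stp b := by
  rw [← hgt_snc c s b n le_rfl]
  unfold hgt
  rw [Finset.sum_range_succ, dif_pos (Nat.lt_succ_self n)]
  simp [snc, Fin.snoc, stp, add_assoc]

lemma forall_le_succ_iff (n : ℕ) (P : ℕ → Prop) :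
    (∀ i ≤ n + 1, P i) ↔ (∀ i ≤ n, P i) ∧ P (n+1) := by
  constructor
  · intro h
    exact ⟨fun i hi => h i (by omega), h _ le_rfl⟩
  · rintro ⟨h1, h2⟩ i hi
    rcases Nat.lt_or_ge n i with h | h
    · have : i = n + 1 := by omega
      subst this; exact h2
    · exact h1 i h

lemma InUHP_snc {n : ℕ} (c : ℤ) (s : Fin n → Bool) (b : Bool) :
    InUHP c (snc s b) ↔ InUHP c s ∧ 0 ≤ hgt c s n + stp b := by
  unfold InUHP
  rw [forall_le_succ_iff, hgt_snc_last]
  refine and_congr_left' (forall₂_congr fun i hi => by rw [hgt_snc c s b i hi])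

lemma visits_snc {n : ℕ} (c : ℤ) (s : Fin n → Bool) (b : Bool) :
    visits c (snc s b) = visits c s + if hgt c s n + stp b = 0 then 1 else 0 := by
  unfold visits
  rw [Finset.card_filter, Finset.card_filter, Finset.sum_range_succ, hgt_snc_last]
  congr 1
  apply Finset.sum_congr rfl
  intro i hi
  rw [hgt_snc c s b i (by simp at hi; omega)]

def Gd {n : ℕ} (s t : Fin n → Bool) : Prop :=
  InUHP 0 s ∧ InUHP 2 t ∧ ∀ i ≤ n, hgt 0 s i < hgt 2 t i

lemma Gd_snc {n : ℕ} (s t : Fin n → Bool) (b c : Bool) :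
    Gd (snc s b) (snc t c) ↔ Gd s t ∧ 0 ≤ hgt 0 s n + stp b ∧
      hgt 0 s n + stp b < hgt 2 t n + stp c := by
  unfold Gd
  rw [InUHP_snc, InUHP_snc, forall_le_succ_iff, hgt_snc_last, hgt_snc_last]
  have : (∀ i ≤ n, hgt 0 (snc s b) i < hgt 2 (snc t c) i) ↔ ∀ i ≤ n, hgt 0 s i < hgt 2 t i :=
    forall₂_congr fun i hi => by rw [hgt_snc _ _ _ i hi, hgt_snc _ _ _ i hi]
  rw [this]
  constructor
  · tauto
  · rintro ⟨⟨h1, h2, h3⟩, h4, h5⟩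
    exact ⟨⟨h1, h4⟩, ⟨h2, by omega⟩, h3, h5⟩

noncomputable def SS (n : ℕ) (x y : ℤ) : ℝ :=
  ∑ s : Fin n → Bool, ∑ t : Fin n → Bool,
    if Gd s t ∧ hgt 0 s n = x ∧ hgt 2 t n = y then (2 : ℝ) ^ visits 0 s else 0

lemma sW_eq (n k m : ℕ) : sW 2 n k m = SS n m (k + 2) := by
  unfold sW SS Gd
  rw [Finset.sum_filter, Fintype.sum_prod_type]
  simp only [and_assoc]

lemma sum_snc {n : ℕ} (f : (Fin (n+1) → Bool) → ℝ) :
    ∑ s, f s = ∑ b : Bool, ∑ s : Fin n → Bool, f (snc s b) := by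
  rw [← (Fin.snocEquiv (fun _ : Fin (n+1) => Bool)).sum_comp, Fintype.sum_prod_type]
  rfl

lemma SS_succ (n : ℕ) (x y : ℤ) : SS (n+1) x y =
    if 0 ≤ x ∧ x < y then (if x = 0 then 2 else 1) *
      ∑ b : Bool, ∑ c : Bool, SS n (x - stp b) (y - stp c) else 0 := by
  unfold SS
  rw [sum_snc]
  simp_rw [sum_snc, Gd_snc, hgt_snc_last, visits_snc]
  split_ifs with h h0
  all_goals try rw [Finset.mul_sum]
  rotate_left 2
  · refine Finset.sum_eq_zero fun b _ => Finset.sum_eq_zero fun s _ =>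
      Finset.sum_eq_zero fun c _ => Finset.sum_eq_zero fun t _ => ?_
    rw [if_neg]
    rintro ⟨⟨_, h1, h2⟩, h3, h4⟩
    omega
  all_goals
    refine Finset.sum_congr rfl fun b _ => ?_
    rw [Finset.sum_comm, Finset.mul_sum]
    refine Finset.sum_congr rfl fun c _ => ?_
    rw [Finset.mul_sum]
    refine Finset.sum_congr rfl fun s _ => ?_
    rw [Finset.mul_sum]
    refine Finset.sum_congr rfl fun t _ => ?_
    by_cases hc : Gd s t ∧ hgt 0 s n = x - stp b ∧ hgt 2 t n = y - stp c
    · have e1 : hgt 0 s n + stp b = x := by omega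
      have e2 : hgt 2 t n + stp c = y := by omega
      rw [if_pos hc, if_pos ⟨⟨hc.1, by omega, by omega⟩, e1, e2⟩, e1]
      simp [h0, pow_succ, mul_comm]
    · rw [if_neg hc, if_neg, mul_zero]
      rintro ⟨⟨h1, _, _⟩, h3, h4⟩
      exact hc ⟨h1, by omega, by omega⟩

lemma SS_zero (x y : ℤ) : SS 0 x y = if x = 0 ∧ y = 2 then 2 else 0 := by
  unfold SS
  simp [Gd, InUHP, hgt, visits, eq_comm]

lemma SS_bad (n : ℕ) (x y : ℤ) (h : ¬ (0 ≤ x ∧ x < y)) : SS n x y = 0 := by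
  cases n with
  | zero => rw [SS_zero, if_neg]; omega
  | succ n => rw [SS_succ, if_neg h]

/-- unrestricted path counts -/
noncomputable def U : ℕ → ℤ → ℝ
  | 0, x => if x = 0 then 1 else 0
  | n+1, x => U n (x-1) + U n (x+1)

lemma U_zero (x : ℤ) : U 0 x = if x = 0 then 1 else 0 := rfl
lemma U_succ (n : ℕ) (x : ℤ) : U (n+1) x = U n (x-1) + U n (x+1) := rfl

lemma U_neg (n : ℕ) : ∀ x : ℤ, U n (-x) = U n x := by
  induction n with
  | zero => intro x; simp [U_zero]
  | succ n ih =>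
    intro x
    rw [U_succ, U_succ, ← ih (x-1), ← ih (x+1), add_comm]
    congr 2 <;> ring

lemma U_odd (n : ℕ) : ∀ x : ℤ, (x + n) % 2 = 1 → U n x = 0 := by
  induction n with
  | zero => intro x hx; rw [U_zero, if_neg]; rintro rfl; simp at hx
  | succ n ih =>
    intro x hx
    push_cast at hx
    rw [U_succ, ih _ (by omega), ih _ (by omega), add_zero]

lemma U_supp (n : ℕ) : ∀ x : ℤ, (n : ℤ) < |x| → U n x = 0 := by
  induction n with
  | zero => intro x hx; rw [U_zero, if_neg]; rintro rfl; simp at hx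
  | succ n ih =>
    intro x hx
    push_cast at hx
    rw [U_succ, ih _ (by grind), ih _ (by grind), add_zero]

noncomputable def B (n : ℕ) (x : ℤ) : ℝ := U n (x-2) + U n (x+2)
noncomputable def G (n : ℕ) (x y : ℤ) : ℝ := U n x * B n y - U n y * B n x

lemma B_neg (n : ℕ) (x : ℤ) : B n (-x) = B n x := by
  unfold B
  rw [← U_neg n (x-2), ← U_neg n (x+2), add_comm]
  congr 2 <;> ring
lemma G_neg_left (n : ℕ) (x y : ℤ) : G n (-x) y = G n x y := by
  unfold G; rw [B_neg, U_neg]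
lemma G_neg_right (n : ℕ) (x y : ℤ) : G n x (-y) = G n x y := by
  unfold G; rw [B_neg, U_neg]
lemma G_swap (n : ℕ) (x y : ℤ) : G n y x = - G n x y := by
  unfold G; ring
lemma G_diag (n : ℕ) (x : ℤ) : G n x x = 0 := by
  unfold G; ring
lemma G_odd (n : ℕ) (x y : ℤ) (h : (x + y) % 2 = 1) : G n x y = 0 := by
  unfold G B
  rcases Int.emod_two_eq_zero_or_one (x + n) with h1 | h1
  · rw [U_odd n y (by omega), U_odd n (y-2) (by omega), U_odd n (y+2) (by omega)]; ring
  · rw [U_odd n x (by omega), U_odd n (x-2) (by omega), U_odd n (x+2) (by omega)]; ring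

lemma G_succ (n : ℕ) (x y : ℤ) : G (n+1) x y =
    G n (x-1) (y-1) + G n (x-1) (y+1) + G n (x+1) (y-1) + G n (x+1) (y+1) := by
  unfold G B
  simp only [U_succ]
  ring_nf

lemma SS_eq_G (n : ℕ) : ∀ x y : ℤ, 0 ≤ x → x < y → SS n x y = 2 * G n x y := by
  induction n with
  | zero =>
    intro x y hx hxy
    rw [SS_zero]
    unfold G B
    simp only [U_zero]
    rw [if_neg (show ¬ y = 0 by omega), if_neg (show ¬ y + 2 = 0 by omega)]
    by_cases h1 : x = 0 <;> by_cases h2 : y = 2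
    · simp [h1, h2]
    · simp [h1, h2, sub_eq_zero]
    · simp [h1]
    · simp [h1]
  | succ n ih =>
    intro x y hx hxy
    have key : SS n (x+1) (y-1) = 2 * G n (x+1) (y-1) := by
      rcases lt_trichotomy (x+1) (y-1) with h | h | h
      · exact ih _ _ (by omega) h
      · rw [h, G_diag, SS_bad _ _ _ (by omega), mul_zero]
      · rw [G_odd _ _ _ (by omega), SS_bad _ _ _ (by omega), mul_zero]
    have k1 := ih (x+1) (y+1) (by omega) (by omega)
    rw [SS_succ, if_pos ⟨hx, hxy⟩, G_succ]
    simp only [Fintype.sum_bool, stp, if_true, Bool.false_eq_true, if_false, sub_neg_eq_add]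
    rw [key, k1]
    by_cases h0 : x = 0
    · subst h0
      rw [SS_bad n (0-1) _ (by omega), SS_bad n (0-1) _ (by omega), if_pos rfl]
      rw [show (0:ℤ) - 1 = -(0+1) by ring, G_neg_left, G_neg_left]
      ring
    · rw [if_neg h0, ih (x-1) (y-1) (by omega) (by omega), ih (x-1) (y+1) (by omega) (by omega)]
      ring

lemma summable_U_mul (n : ℕ) (a : ℤ) (f : ℤ → ℝ) : Summable (fun x => U n (x + a) * f x) := by
  apply summable_of_ne_finset_zero (s := Finset.Icc (-(n:ℤ) - a) (n - a))
  intro x hx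
  rw [U_supp, zero_mul]
  rw [Finset.mem_Icc] at hx
  grind

lemma tsum_U_shift (n : ℕ) (a : ℤ) (f : ℤ → ℝ) :
    ∑' x, U n (x + a) * f x = ∑' x, U n x * f (x - a) := by
  rw [← (Equiv.addRight a).tsum_eq (fun x => U n x * f (x - a))]
  simp

lemma U_conv (n : ℕ) : ∀ (q : ℕ) (d : ℤ), ∑' x, U n x * U q (d - x) = U (n + q) d := by
  induction n with
  | zero =>
    intro q d
    rw [tsum_eq_single 0]
    · simp [U_zero]
    · intro b hb; simp [U_zero, hb]
  | succ n ih =>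
    intro q d
    have h1 : ∀ x : ℤ, U (n+1) x * U q (d - x) =
        U n (x + (-1)) * U q (d - x) + U n (x + 1) * U q (d - x) := by
      intro x; rw [U_succ]; ring_nf
    simp_rw [h1]
    rw [(summable_U_mul n _ _).tsum_add (summable_U_mul n _ _), tsum_U_shift, tsum_U_shift]
    rw [show n + 1 + q = (n + q) + 1 by ring, U_succ, ← ih q (d-1), ← ih q (d+1)]
    congr 1 <;> refine tsum_congr fun x => ?_ <;> congr 2 <;> ring

/-- the window of summation -/
noncomputable def Iw (n : ℕ) : Finset ℤ := Finset.Icc (-((n + 2 : ℕ) : ℤ)) ((n + 2 : ℕ) : ℤ)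

lemma corr (n : ℕ) (a b : ℤ) (ha : |a| ≤ 2) :
    ∑ x ∈ Iw n, U n (x + a) * U n (x + b) = U (2 * n) (b - a) := by
  rw [← tsum_eq_sum (L := SummationFilter.unconditional ℤ), tsum_U_shift, two_mul, ← U_neg (n+n), ← U_conv n n]
  · refine tsum_congr fun x => ?_
    rw [← U_neg n (x - a + b)]
    congr 2; ring
  · intro x hx
    rw [U_supp, zero_mul]
    rw [Iw, Finset.mem_Icc] at hx
    push_cast at hx
    grind

lemma sum_AA (n : ℕ) : ∑ x ∈ Iw n, U n x ^ 2 = U (2*n) 0 := by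
  have := corr n 0 0 (by simp)
  simpa [sq] using this

lemma sum_AB (n : ℕ) : ∑ x ∈ Iw n, U n x * B n x = 2 * U (2*n) 2 := by
  have h1 := corr n 0 2 (by simp)
  have h2 := corr n 0 (-2) (by simp)
  simp only [add_zero, sub_zero] at h1 h2
  rw [U_neg] at h2
  rw [two_mul]
  nth_rewrite 1 [← h2]
  rw [← h1, ← Finset.sum_add_distrib]
  refine Finset.sum_congr rfl fun x _ => ?_
  unfold B; ring_nf

lemma sum_BB (n : ℕ) : ∑ x ∈ Iw n, B n x ^ 2 = 2 * U (2*n) 0 + 2 * U (2*n) 4 := by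
  have h1 := corr n 2 2 (by simp)
  have h2 := corr n (-2) (-2) (by simp)
  have h3 := corr n (-2) 2 (by simp)
  norm_num at h1 h2 h3
  calc _ = ∑ x ∈ Iw n, (U n (x+2) * U n (x+2) + U n (x + -2) * U n (x + -2)
            + 2 * (U n (x + -2) * U n (x + 2))) := by
          refine Finset.sum_congr rfl fun x _ => ?_
          unfold B; ring_nf
    _ = _ := by
          rw [Finset.sum_add_distrib, Finset.sum_add_distrib, ← Finset.mul_sum, h1, h2, h3]; ring

lemma row_sum (n : ℕ) (x : ℤ) : ∑ y ∈ Iw n, G n x y ^ 2 =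
    U n x ^ 2 * (2 * U (2*n) 0 + 2 * U (2*n) 4) - (U n x * B n x) * (4 * U (2*n) 2)
      + B n x ^ 2 * U (2*n) 0 := by
  have : ∀ y, G n x y ^ 2 = U n x ^ 2 * B n y ^ 2 - 2 * (U n x * B n x) * (U n y * B n y)
      + B n x ^ 2 * U n y ^ 2 := by intro y; unfold G; ring
  simp_rw [this]
  rw [Finset.sum_add_distrib, Finset.sum_sub_distrib, ← Finset.mul_sum, ← Finset.mul_sum,
    ← Finset.mul_sum, sum_AA, sum_AB, sum_BB]
  ring

lemma total_sum (n : ℕ) : ∑ x ∈ Iw n, ∑ y ∈ Iw n, G n x y ^ 2 =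
    2 * (U (2*n) 0 * (2 * U (2*n) 0 + 2 * U (2*n) 4) - 4 * U (2*n) 2 ^ 2) := by
  simp_rw [row_sum]
  rw [Finset.sum_add_distrib, Finset.sum_sub_distrib, ← Finset.sum_mul, ← Finset.sum_mul,
    ← Finset.sum_mul, sum_AA, sum_AB, sum_BB]
  ring

lemma fold_even (h : ℤ → ℝ) (he : ∀ x, h (-x) = h x) (M : ℕ) :
    ∑ x ∈ Finset.Icc (-(M:ℤ)) M, h x = h 0 + 2 * ∑ m ∈ Finset.Icc 1 M, h (m : ℤ) := by
  induction M with
  | zero => simp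
  | succ M ih =>
    have : Finset.Icc (-((M+1:ℕ):ℤ)) ((M+1:ℕ):ℤ) =
        insert (-((M+1:ℕ):ℤ)) (insert ((M+1:ℕ):ℤ) (Finset.Icc (-(M:ℤ)) M)) := by
      ext x
      simp only [Finset.mem_insert, Finset.mem_Icc]
      push_cast
      omega
    rw [this, Finset.sum_insert, Finset.sum_insert, ih, Finset.sum_Icc_succ_top (by omega), he]
    · ring
    · simp
    · simp only [Finset.mem_insert, Finset.mem_Icc]
      push_cast
      omega

lemma triangle (f : ℕ → ℕ → ℝ) (hs : ∀ x y, f x y = f y x) (hd : ∀ x, f x x = 0) (M : ℕ) :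
    ∑ x ∈ Finset.Icc 1 M, ∑ y ∈ Finset.Icc 1 M, f x y =
      2 * ∑ k ∈ Finset.range M, ∑ m ∈ Finset.Icc 1 k, f m (k+1) := by
  induction M with
  | zero => simp
  | succ M ih =>
    rw [Finset.sum_Icc_succ_top (by omega), Finset.sum_range_succ]
    simp_rw [Finset.sum_Icc_succ_top (show 1 ≤ M + 1 by omega)]
    rw [Finset.sum_add_distrib, ih, hd]
    simp_rw [hs (M+1)]
    ring

lemma fold_total (n : ℕ) : ∑ x ∈ Iw n, ∑ y ∈ Iw n, G n x y ^ 2 =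
    2 * ∑ y ∈ Iw n, G n 0 y ^ 2 +
      8 * ∑ k ∈ Finset.range (n+1), ∑ m ∈ Finset.Icc 1 k, G n m ((k:ℤ) + 2) ^ 2 := by
  have hrow : ∀ x, ∑ y ∈ Iw n, G n x y ^ 2 =
      G n x 0 ^ 2 + 2 * ∑ m ∈ Finset.Icc 1 (n+2), G n x (m:ℤ) ^ 2 := fun x =>
    fold_even (fun y => G n x y ^ 2) (fun y => by simp only [G_neg_right]) (n+2)
  have h1 : ∑ x ∈ Iw n, ∑ y ∈ Iw n, G n x y ^ 2 = _ :=
    fold_even (fun x => ∑ y ∈ Iw n, G n x y ^ 2) (fun x => by simp only [G_neg_left]) (n+2)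
  have h2 := triangle (fun x y => G n x y ^ 2) (fun x y => by rw [G_swap, neg_sq])
    (fun x => by simp [G_diag]) (n+2)
  have h3 : ∀ x : ℤ, G n x 0 ^ 2 = G n 0 x ^ 2 := fun x => by rw [G_swap, neg_sq]
  have h4 := hrow 0
  rw [G_diag] at h4
  rw [h1]
  simp_rw [hrow, h3]
  rw [G_diag, Finset.sum_add_distrib, ← Finset.mul_sum, h2, Finset.sum_range_succ']
  have h5 : ∀ k : ℕ, ∑ m ∈ Finset.Icc 1 (k+1), G n (m:ℤ) ((k+1+1:ℕ):ℤ) ^ 2 =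
      ∑ m ∈ Finset.Icc 1 k, G n m ((k:ℤ) + 2) ^ 2 := by
    intro k
    rw [Finset.sum_Icc_succ_top (by omega), G_odd n ((k+1:ℕ):ℤ) _ (by push_cast; omega)]
    push_cast
    simp [add_assoc, one_add_one_eq_two]
  simp_rw [h5]
  simp
  ring

lemma PG2_eq (n : ℕ) : PG2 (2 * (n+1)) 2 1 =
    U (2*n) 0 * (2 * U (2*n) 0 + 2 * U (2*n) 4) - 4 * U (2*n) 2 ^ 2
      - ∑ y ∈ Iw n, G n 0 y ^ 2 := by
  have h1 := total_sum n
  rw [fold_total] at h1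
  have h2 : PG2 (2 * (n+1)) 2 1 =
      4 * ∑ k ∈ Finset.range (n+1), ∑ m ∈ Finset.Icc 1 k, G n m ((k:ℤ) + 2) ^ 2 := by
    unfold PG2
    rw [show (2 * (n+1) - 2) / 2 = n by omega, Finset.mul_sum]
    refine Finset.sum_congr rfl fun k _ => ?_
    rw [Finset.mul_sum]
    refine Finset.sum_congr rfl fun m hm => ?_
    rw [Finset.mem_Icc] at hm
    rw [sW_eq, SS_eq_G _ _ _ (by omega) (by omega)]
    simp; ring
  rw [h2]; linarith

lemma U_ratio (n : ℕ) : ∀ x : ℤ, ((n:ℝ) + x + 2) * U n (x+2) = (n - x) * U n x := by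
  induction n with
  | zero =>
    intro x
    simp only [U_zero]
    by_cases h : x = 0
    · subst h; norm_num
    · by_cases h' : x + 2 = 0
      · have : (x:ℝ) + 2 = 0 := by exact_mod_cast h'
        simp [h, this]
      · simp [h, h']
  | succ n ih =>
    intro x
    have h1 := ih (x+1)
    have h2 := ih (x-1)
    rw [show x + 1 + 2 = x + 3 by ring] at h1
    rw [show x - 1 + 2 = x + 1 by ring] at h2
    rw [U_succ, U_succ, show x + 2 - 1 = x + 1 by ring, show x + 2 + 1 = x + 3 by ring]
    push_cast at *
    linarith

lemma c1_eq (n : ℕ) : U (2*n) 2 = n / (n+1) * U (2*n) 0 := by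
  have := U_ratio (2*n) 0
  push_cast at this
  norm_num at this
  field_simp
  linarith

lemma c2_eq (n : ℕ) : U (2*n) 4 = (n-1) / (n+2) * U (2*n) 2 := by
  have := U_ratio (2*n) 2
  push_cast at this
  norm_num at this
  field_simp
  linarith

lemma B0_eq (n : ℕ) : B n 0 = 2 * n / (n+2) * U n 0 := by
  have := U_ratio n 0
  norm_num at this
  unfold B
  rw [show (0:ℤ) - 2 = -2 by ring, U_neg, show (0:ℤ)+2 = 2 by ring]
  field_simp
  linarith

lemma c0_succ (n : ℕ) : U (2*(n+1)) 0 = 2 * (2*n+1) / (n+1) * U (2*n) 0 := by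
  rw [show 2*(n+1) = 2*n+1+1 by ring, U_succ, U_succ, U_succ]
  rw [show (0:ℤ) - 1 - 1 = -2 by ring, U_neg, show (0:ℤ)-1+1 = 0 by ring,
    show (0:ℤ)+1-1 = 0 by ring, show (0:ℤ)+1+1 = 2 by ring, c1_eq]
  field_simp
  ring

lemma c0_sq (n : ℕ) : U (2*n) 0 ^ 2 * ((2*n+1) * Real.Wallis.W n) = 16 ^ n := by
  induction n with
  | zero => simp [U_zero, Real.Wallis.W]
  | succ n ih =>
    rw [c0_succ, Real.Wallis.W_succ, pow_succ (16:ℝ) n, ← ih]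
    push_cast
    field_simp
    ring

lemma W_ge (n : ℕ) : 1 / 2 ≤ Real.Wallis.W n := by
  refine le_trans ?_ (Real.Wallis.le_W n)
  have hp := Real.pi_gt_three
  have : (1:ℝ) / 2 ≤ (2 * n + 1) / (2 * n + 2) := by
    rw [div_le_div_iff₀ (by norm_num) (by positivity)]
    have : (0:ℝ) ≤ n := by positivity
    linarith
  nlinarith

lemma A0_bound (n : ℕ) : U n 0 ^ 2 * (n + 1) ≤ 2 * 4 ^ n := by
  rcases Nat.even_or_odd' n with ⟨k, rfl | rfl⟩
  · have h := c0_sq k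
    have hw := W_ge k
    have h0 : 0 ≤ U (2*k) 0 ^ 2 * (2*k+1) := by positivity
    rw [pow_mul, show (4:ℝ)^2 = 16 by norm_num, ← h]
    push_cast
    nlinarith
  · rw [U_odd _ _ (by push_cast; omega)]
    simp

lemma c0_nonneg (n : ℕ) : ∀ x, 0 ≤ U n x := by
  induction n with
  | zero => intro x; rw [U_zero]; split_ifs <;> norm_num
  | succ n ih => intro x; exact add_nonneg (ih _) (ih _)

noncomputable def Ax (n : ℕ) : ℝ := ∑ y ∈ Iw n, G n 0 y ^ 2

lemma Ax_eq (n : ℕ) : Ax n = U n 0 ^ 2 * U (2*n) 0 * ((12 * n + 8) / ((n+1) * (n+2)^2)) := by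
  unfold Ax
  rw [row_sum, B0_eq, c2_eq, c1_eq]
  field_simp
  ring

lemma Ax_nonneg (n : ℕ) : 0 ≤ Ax n := Finset.sum_nonneg fun _ _ => sq_nonneg _

lemma Ax_bound (n : ℕ) : Ax n * (n+1)^3 / (2 * 16 ^ n) ≤ 12 * (U (2*n) 0 / 4 ^ n) := by
  have h1 : ((12 * n + 8) / ((n+1) * (n+2)^2) : ℝ) * (n+1)^3 ≤ 12 * (n + 1) := by
    rw [div_mul_eq_mul_div, div_le_iff₀ (by positivity)]
    have : (0:ℝ) ≤ n := by positivity
    have : (0:ℝ) ≤ 12 * (n+1) * ((n+1) * (n+2)^2) - (12 * n + 8) * (n+1)^3 := by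
      ring_nf; positivity
    linarith
  have h2 := A0_bound n
  have h3 := c0_nonneg (2*n) 0
  rw [show (16:ℝ) = 4 * 4 by norm_num, mul_pow, ← mul_div_assoc, div_le_div_iff₀ (by positivity) (by positivity)]
  have h4 : Ax n * (n+1)^3 ≤ 24 * 4 ^ n * U (2*n) 0 := by
    rw [Ax_eq]
    calc _ = U n 0 ^ 2 * U (2*n) 0 * ((12 * n + 8) / ((n+1) * (n+2)^2) * (n+1)^3) := by ring
      _ ≤ U n 0 ^ 2 * U (2*n) 0 * (12 * (n+1)) := by gcongr
      _ = 12 * U (2*n) 0 * (U n 0 ^ 2 * (n+1)) := by ring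
      _ ≤ 12 * U (2*n) 0 * (2 * 4 ^ n) := by gcongr
      _ = _ := by ring
  calc _ ≤ 24 * 4 ^ n * U (2*n) 0 * 4 ^ n := by gcongr
    _ = _ := by ring

lemma c0_div_tendsto : Tendsto (fun n : ℕ => U (2*n) 0 / 4 ^ n) atTop (nhds 0) := by
  have h : ∀ n : ℕ, U (2*n) 0 / 4 ^ n = Real.sqrt (1 / (2*n+1) * (Real.Wallis.W n)⁻¹) := by
    intro n
    have hw := Real.Wallis.W_pos n
    rw [eq_comm, Real.sqrt_eq_iff_mul_self_eq (by positivity)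
      (div_nonneg (c0_nonneg _ _) (by positivity))]
    have h := c0_sq n
    rw [show (16:ℝ) = 4 * 4 by norm_num, mul_pow] at h
    field_simp
    linarith
  simp_rw [h]
  have h1 : Tendsto (fun n : ℕ => (1:ℝ) / (2*n+1)) atTop (nhds 0) := by
    refine tendsto_const_nhds.div_atTop ?_
    exact tendsto_atTop_add_const_right _ _
      (tendsto_natCast_atTop_atTop.const_mul_atTop (by norm_num))
  have h2 := (h1.mul (Real.Wallis.tendsto_W_nhds_pi_div_two.inv₀ (by positivity))).sqrt
  simpa using h2

lemma final_eq (n : ℕ) : PG2 (2 * (n+1)) 2 1 * ((2 * (n+1) : ℕ) : ℝ) ^ 3 / (4:ℝ) ^ (2 * (n+1)) =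
    2 * (1 - 1 / ((n:ℝ) + 2)) * (Real.Wallis.W n)⁻¹ - Ax n * (n+1)^3 / (2 * 16 ^ n) := by
  have hw := Real.Wallis.W_pos n
  have h := c0_sq n
  have hc : U (2*n) 0 ^ 2 = 16 ^ n / ((2*n+1) * Real.Wallis.W n) := by
    field_simp; linarith
  have h1 : PG2 (2 * (n+1)) 2 1 =
      U (2*n) 0 ^ 2 * (4 * (2*n+1) / ((n+1)^2 * (n+2))) - Ax n := by
    rw [PG2_eq, c2_eq, c1_eq, Ax]
    field_simp
    ring
  rw [h1, hc, pow_mul, pow_succ, show (4:ℝ)^2 = 16 by norm_num]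
  push_cast
  field_simp
  ring

/-- Asymptotics of `P^{G2}_{2n}(2,1)` along even `n`. -/
theorem PG2_asymp_a2_y1 :
    Tendsto (fun j : ℕ =>
        PG2 (2 * j) 2 1 * ((2 * j : ℕ) : ℝ) ^ 3 / (4 : ℝ) ^ (2 * j))
      atTop (nhds (4 / Real.pi)) := by
  rw [← tendsto_add_atTop_iff_nat 1]
  simp_rw [final_eq]
  have h1 : Tendsto (fun n : ℕ => (1:ℝ) / (n+2)) atTop (nhds 0) :=
    tendsto_const_nhds.div_atTop (tendsto_atTop_add_const_right _ _ tendsto_natCast_atTop_atTop)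
  have h2 : Tendsto (fun n : ℕ => Ax n * (n+1)^3 / (2 * 16 ^ n)) atTop (nhds 0) := by
    refine squeeze_zero (fun n => ?_) Ax_bound ?_
    · have := Ax_nonneg n
      positivity
    · simpa using c0_div_tendsto.const_mul 12
  have h3 := (((h1.const_sub 1).const_mul 2).mul
    (Real.Wallis.tendsto_W_nhds_pi_div_two.inv₀ (by positivity))).sub h2
  convert h3 using 2
  have := Real.pi_pos
  field_simp
  norm_num
end

section
/- Fix 0 < a < 2. As n → ∞ along integers n ≡ 2 (mod 4), one has P^{G1}_{2n}(a,1) · n^{13/2} · 4^{−n} → 1920√2 a⁴ / (π^{3/2}(a−2)⁶); that is, P^{G1}_{2n}(a,1) is asymptotic to [1920√2 a⁴/(π^{3/2}(a−2)⁶)] · 4^n / n^{13/2}. -/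
open Finset Filter

attribute [local instance] Classical.propDecidable

/-- `P^{G1}_{2n}(a,y) = Σ_{k=0}^{(n-2)/2} (s_{(n-2)/2}(k,0))² y^{k+2}` (for even `n`). -/
noncomputable def PG1 (n : ℕ) (a y : ℝ) : ℝ :=
  ∑ k ∈ Finset.range ((n - 2) / 2 + 1), (sW a ((n - 2) / 2) k 0) ^ 2 * y ^ (k + 2)

lemma hgt_zero {n : ℕ} (c : ℤ) (s : Fin n → Bool) : hgt c s 0 = c := by
  simp [hgt]

lemma hgt_snoc_le {n : ℕ} (c : ℤ) (s : Fin n → Bool) (b : Bool) (i : ℕ) (hi : i ≤ n) :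
    hgt c (Fin.snoc (α := fun _ => Bool) s b) i = hgt c s i := by
  unfold hgt
  congr 1
  apply Finset.sum_congr rfl
  intro j hj
  have hj' : j < n := lt_of_lt_of_le (Finset.mem_range.mp hj) hi
  have hj2 : j < n + 1 := by omega
  rw [dif_pos hj', dif_pos hj2]
  have : (⟨j, hj2⟩ : Fin (n + 1)) = Fin.castSucc ⟨j, hj'⟩ := rfl
  rw [this, Fin.snoc_castSucc (α := fun _ => Bool)]

lemma hgt_snoc_last {n : ℕ} (c : ℤ) (s : Fin n → Bool) (b : Bool) :
    hgt c (Fin.snoc (α := fun _ => Bool) s b) (n + 1) = hgt c s n + stp b := by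
  have h := hgt_snoc_le c s b n le_rfl
  have h2 : hgt c (Fin.snoc (α := fun _ => Bool) s b) (n + 1)
      = hgt c (Fin.snoc (α := fun _ => Bool) s b) n + stp b := by
    conv_lhs => unfold hgt
    rw [Finset.sum_range_succ, ← add_assoc]
    congr 1
    rw [dif_pos (Nat.lt_succ_self n)]
    have : (⟨n, Nat.lt_succ_self n⟩ : Fin (n + 1)) = Fin.last n := rfl
    rw [this, Fin.snoc_last (α := fun _ => Bool)]
    rfl
  rw [h2, h]

lemma visits_snoc {n : ℕ} (c : ℤ) (s : Fin n → Bool) (b : Bool) :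
    visits c (Fin.snoc (α := fun _ => Bool) s b)
      = visits c s + if hgt c s n + stp b = 0 then 1 else 0 := by
  unfold visits
  rw [Finset.card_filter, Finset.card_filter, Finset.sum_range_succ, hgt_snoc_last]
  congr 1
  apply Finset.sum_congr rfl
  intro i hi
  rw [hgt_snoc_le c s b i (by have := Finset.mem_range.mp hi; omega)]

/-- The condition on pairs of paths, with end heights `x`, `y`. -/
def Good {n : ℕ} (s t : Fin n → Bool) (x y : ℤ) : Prop :=
  InUHP 0 s ∧ InUHP 2 t ∧ (∀ i ≤ n, hgt 0 s i < hgt 2 t i) ∧ hgt 0 s n = x ∧ hgt 2 t n = y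

lemma good_snoc {n : ℕ} (s t : Fin n → Bool) (b c : Bool) (x y : ℤ) :
    Good (Fin.snoc (α := fun _ => Bool) s b) (Fin.snoc (α := fun _ => Bool) t c) x y
      ↔ (0 ≤ x ∧ x < y) ∧ Good s t (x - stp b) (y - stp c) := by
  unfold Good InUHP
  constructor
  · rintro ⟨h1, h2, h3, h4, h5⟩
    have e1 := h1 (n + 1) le_rfl
    have e3 := h3 (n + 1) le_rfl
    rw [hgt_snoc_last] at h4 h5
    rw [hgt_snoc_last] at e1
    rw [hgt_snoc_last, hgt_snoc_last] at e3
    refine ⟨⟨by omega, by omega⟩, ?_, ?_, ?_, by omega, by omega⟩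
    · intro i hi
      have := h1 i (by omega)
      rwa [hgt_snoc_le _ _ _ _ hi] at this
    · intro i hi
      have := h2 i (by omega)
      rwa [hgt_snoc_le _ _ _ _ hi] at this
    · intro i hi
      have := h3 i (by omega)
      rwa [hgt_snoc_le _ _ _ _ hi, hgt_snoc_le _ _ _ _ hi] at this
  · rintro ⟨⟨hx, hxy⟩, h1, h2, h3, h4, h5⟩
    refine ⟨?_, ?_, ?_, ?_, ?_⟩
    · intro i hi
      rcases Nat.lt_or_ge n i with h | h
      · obtain rfl : i = n + 1 := by omega
        rw [hgt_snoc_last]; omega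
      · rw [hgt_snoc_le _ _ _ _ h]; exact h1 i h
    · intro i hi
      rcases Nat.lt_or_ge n i with h | h
      · obtain rfl : i = n + 1 := by omega
        rw [hgt_snoc_last]; omega
      · rw [hgt_snoc_le _ _ _ _ h]; exact h2 i h
    · intro i hi
      rcases Nat.lt_or_ge n i with h | h
      · obtain rfl : i = n + 1 := by omega
        rw [hgt_snoc_last, hgt_snoc_last]; omega
      · rw [hgt_snoc_le _ _ _ _ h, hgt_snoc_le _ _ _ _ h]; exact h3 i h
    · rw [hgt_snoc_last]; omega
    · rw [hgt_snoc_last]; omega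

/-- Weighted pair sum with end heights `x`, `y`. -/
noncomputable def ZZ (a : ℝ) (n : ℕ) (x y : ℤ) : ℝ :=
  ∑ s : Fin n → Bool, ∑ t : Fin n → Bool, if Good s t x y then a ^ visits 0 s else 0

lemma sW_eq_ZZ (a : ℝ) (n k : ℕ) : sW a n k 0 = ZZ a n 0 ((k : ℤ) + 2) := by
  unfold sW ZZ
  rw [Finset.sum_filter, Fintype.sum_prod_type]
  exact Finset.sum_congr rfl fun s _ => Finset.sum_congr rfl fun t _ =>
    if_congr Iff.rfl rfl rfl

lemma sum_snoc {n : ℕ} (f : (Fin (n + 1) → Bool) → ℝ) :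
    ∑ s, f s = ∑ s : Fin n → Bool, (f (Fin.snoc (α := fun _ => Bool) s true)
      + f (Fin.snoc (α := fun _ => Bool) s false)) := by
  rw [← (Fin.snocEquiv (fun _ : Fin (n + 1) => Bool)).sum_comp, Fintype.sum_prod_type]
  simp only [Fintype.sum_bool, Finset.sum_add_distrib]
  rfl

lemma term_snoc (a : ℝ) {n : ℕ} (s t : Fin n → Bool) (b c : Bool) (x y : ℤ) :
    (if Good (Fin.snoc (α := fun _ => Bool) s b) (Fin.snoc (α := fun _ => Bool) t c) x y
      then a ^ visits 0 (Fin.snoc (α := fun _ => Bool) s b) else 0)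
    = (if 0 ≤ x ∧ x < y then (if x = 0 then a else 1) else 0) *
      (if Good s t (x - stp b) (y - stp c) then a ^ visits 0 s else 0) := by
  by_cases hxy : 0 ≤ x ∧ x < y
  · by_cases hg : Good s t (x - stp b) (y - stp c)
    · rw [if_pos ((good_snoc s t b c x y).2 ⟨hxy, hg⟩), if_pos hxy, if_pos hg, visits_snoc]
      have h4 : hgt 0 s n + stp b = x := by have := hg.2.2.2.1; omega
      rw [h4, pow_add, mul_comm]
      by_cases hx : x = 0 <;> simp [hx]
    · rw [if_neg (fun h => hg ((good_snoc s t b c x y).1 h).2), if_neg hg, mul_zero]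
  · rw [if_neg (fun h => hxy ((good_snoc s t b c x y).1 h).1), if_neg hxy, zero_mul]

lemma ZZ_succ (a : ℝ) (n : ℕ) (x y : ℤ) :
    ZZ a (n + 1) x y = (if 0 ≤ x ∧ x < y then (if x = 0 then a else 1) else 0) *
      (ZZ a n (x - 1) (y - 1) + ZZ a n (x - 1) (y + 1)
        + ZZ a n (x + 1) (y - 1) + ZZ a n (x + 1) (y + 1)) := by
  unfold ZZ
  rw [sum_snoc]
  simp only [sum_snoc (n := n), term_snoc]
  simp only [Finset.sum_add_distrib, ← Finset.mul_sum, stp, if_true, sub_neg_eq_add,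
    Bool.false_eq_true, if_false]
  ring

lemma ZZ_zero (a : ℝ) (x y : ℤ) : ZZ a 0 x y = if x = 0 ∧ y = 2 then a else 0 := by
  have hv : ∀ s : Fin 0 → Bool, visits 0 s = 1 := by
    intro s
    unfold visits
    rw [Finset.card_filter, Finset.sum_range_succ, Finset.sum_range_zero, hgt_zero]
    simp
  have hg : ∀ s t : Fin 0 → Bool, Good s t x y ↔ (x = 0 ∧ y = 2) := by
    intro s t
    unfold Good InUHP
    constructor
    · rintro ⟨-, -, -, h4, h5⟩
      rw [hgt_zero] at h4 h5
      exact ⟨h4.symm, h5.symm⟩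
    · rintro ⟨rfl, rfl⟩
      refine ⟨?_, ?_, ?_, ?_, ?_⟩ <;> simp [hgt_zero]
  unfold ZZ
  simp only [hv, hg]
  simp

/-- One-path transfer recursion, started from a unit mass at height `0`
(the weight of the initial vertex is not counted). -/
noncomputable def ww (a : ℝ) : ℕ → ℤ → ℝ
  | 0, x => if x = 0 then 1 else 0
  | n + 1, x => if x < 0 then 0 else (if x = 0 then a else 1) * (ww a n (x - 1) + ww a n (x + 1))

lemma ww_neg (a : ℝ) (n : ℕ) (x : ℤ) (hx : x < 0) : ww a n x = 0 := by
  cases n with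
  | zero => simp [ww, hx.ne]
  | succ n => simp [ww, hx]

lemma ww_succ_pos (a : ℝ) (n : ℕ) (x : ℤ) (hx : 0 < x) :
    ww a (n + 1) x = ww a n (x - 1) + ww a n (x + 1) := by
  simp [ww, hx.ne', not_lt.2 hx.le]

lemma ww_succ_zero (a : ℝ) (n : ℕ) : ww a (n + 1) 0 = a * ww a n 1 := by
  simp [ww, ww_neg a n (-1) (by norm_num)]

lemma ww_two (a : ℝ) (x : ℤ) :
    ww a 2 x = (if x = 0 then a else 0) + (if x = 2 then 1 else 0) := by
  rcases lt_trichotomy x 0 with h | h | h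
  · rw [ww_neg a _ _ h, if_neg h.ne, if_neg (by omega)]; simp
  · subst h
    rw [ww_succ_zero, ww_succ_pos _ _ _ one_pos]
    simp [ww]
  · rw [ww_succ_pos _ _ _ h, ww_succ_pos a 0 (x + 1) (by omega)]
    rcases eq_or_ne x 1 with rfl | h1
    · norm_num [ww_succ_zero, ww]
    · rw [ww_succ_pos a 0 (x - 1) (by omega), if_neg h.ne']
      by_cases h2 : x = 2
      · subst h2; norm_num [ww]
      · simp only [ww]
        rw [if_neg (by omega), if_neg (by omega), if_neg (by omega), if_neg (by omega),
          if_neg h2]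
        simp

lemma ZZ_eq (a : ℝ) (n : ℕ) : ∀ x y : ℤ, x ≤ y → Even (y - x) →
    ZZ a n x y = a * (ww a n x * ww a (n + 2) y - ww a n y * ww a (n + 2) x) := by
  induction n with
  | zero =>
    intro x y hxy _
    rw [ZZ_zero, zero_add, ww_two, ww_two]
    simp only [ww]
    by_cases hx : x = 0 <;> by_cases hy : y = 0 <;> by_cases hy2 : y = 2 <;>
      by_cases hx2 : x = 2 <;> simp [hx, hy, hy2, hx2] <;> omega
  | succ n ih =>
    intro x y hxy hev
    rw [ZZ_succ]
    rcases lt_or_ge x 0 with hx | hx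
    · rw [if_neg (by omega), ww_neg a _ x hx, ww_neg a _ x hx]; ring
    rcases eq_or_lt_of_le hxy with h | h
    · subst h; rw [if_neg (by omega)]; ring
    rw [if_pos ⟨hx, h⟩]
    obtain ⟨d, hd⟩ := hev
    rw [ih (x - 1) (y - 1) (by omega) ⟨d, by omega⟩, ih (x - 1) (y + 1) (by omega) ⟨d + 1, by omega⟩,
      ih (x + 1) (y - 1) (by omega) ⟨d - 1, by omega⟩, ih (x + 1) (y + 1) (by omega) ⟨d, by omega⟩]
    rw [ww_succ_pos a n y (by omega), show n + 1 + 2 = (n + 2) + 1 by ring,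
      ww_succ_pos a (n + 2) y (by omega)]
    rcases eq_or_lt_of_le hx with h0 | h0
    · subst h0
      rw [if_pos rfl, ww_succ_zero, ww_succ_zero, ww_neg a n (0 - 1) (by norm_num),
        ww_neg a (n + 2) (0 - 1) (by norm_num)]
      simp only [zero_add]
      ring
    · rw [if_neg h0.ne', ww_succ_pos a n x h0, ww_succ_pos a (n + 2) x h0]
      ring

lemma ZZ_odd (a : ℝ) (n : ℕ) : ∀ x y : ℤ, ¬ Even (y - x) → ZZ a n x y = 0 := by
  induction n with
  | zero =>
    intro x y h
    rw [ZZ_zero, if_neg]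
    rintro ⟨rfl, rfl⟩
    exact h ⟨1, by norm_num⟩
  | succ n ih =>
    intro x y h
    rw [ZZ_succ, ih, ih, ih, ih]
    · ring
    all_goals
      rintro ⟨d, hd⟩
      first
        | exact h ⟨d, by omega⟩
        | exact h ⟨d - 1, by omega⟩
        | exact h ⟨d + 1, by omega⟩

/-- The comparison with the ballot numbers (`a = 1`). -/
lemma ww_ballot (a : ℝ) (n : ℕ) : ∀ x : ℤ, 0 ≤ x →
    ww a n x = ww 1 n x + (a - 1) * ww a n (x + 2) := by
  induction n with
  | zero =>
    intro x hx
    simp only [ww]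
    rw [if_neg (show ¬ x + 2 = 0 by omega)]; ring
  | succ n ih =>
    intro x hx
    rcases eq_or_lt_of_le hx with h0 | h0
    · subst h0
      rw [ww_succ_zero, ww_succ_zero, ww_succ_pos _ _ _ (by norm_num)]
      have := ih 1 (by norm_num)
      norm_num at this ⊢
      linear_combination this
    · rw [ww_succ_pos _ _ _ h0, ww_succ_pos _ _ _ h0, ww_succ_pos _ _ _ (by omega)]
      have h1 := ih (x - 1) (by omega)
      have h2 := ih (x + 1) (by omega)
      rw [show x - 1 + 2 = x + 2 - 1 by ring] at h1
      rw [show x + 1 + 2 = x + 2 + 1 by ring] at h2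
      rw [h1, h2]; ring

lemma ww_one (n : ℕ) : ∀ p : ℕ, n ≤ 2 * p + 1 →
    ww 1 n (2 * (p : ℤ) - n) = (n.choose p : ℝ) - (n.choose (p + 1) : ℝ) := by
  induction n with
  | zero =>
    intro p _
    rcases Nat.eq_zero_or_pos p with h | h
    · subst h; simp [ww]
    · simp [ww, Nat.choose_eq_zero_of_lt h, h.ne']
  | succ n ih =>
    intro p hp
    rcases Nat.lt_or_ge (2 * p) (n + 1) with h | h
    · obtain rfl : n = 2 * p := by omega
      rw [ww_neg _ _ _ (by push_cast; omega)]
      have : (2 * p + 1).choose p = (2 * p + 1).choose (p + 1) := by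
        rw [← Nat.choose_symm_half]
      rw [this, sub_self]
    · obtain ⟨q, rfl⟩ : ∃ q, p = q + 1 := ⟨p - 1, by omega⟩
      have h1 := ih q (by omega)
      have h2 := ih (q + 1) (by omega)
      have e1 : (2 * ((q + 1 : ℕ) : ℤ) - ((n + 1 : ℕ) : ℤ)) - 1 = 2 * (q : ℤ) - n := by
        push_cast; ring
      have e2 : (2 * ((q + 1 : ℕ) : ℤ) - ((n + 1 : ℕ) : ℤ)) + 1 = 2 * ((q + 1 : ℕ) : ℤ) - n := by
        push_cast; ring
      have : ww 1 (n + 1) (2 * ((q + 1 : ℕ) : ℤ) - ((n + 1 : ℕ) : ℤ))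
          = ww 1 n (2 * (q : ℤ) - n) + ww 1 n (2 * ((q + 1 : ℕ) : ℤ) - n) := by
        rw [ww, if_neg (by push_cast; omega), e1, e2]
        simp
      rw [this, h1, h2, Nat.choose_succ_succ, Nat.choose_succ_succ n (q + 1)]
      push_cast; ring

/-! ### Part 2: exact formula for `PG1` -/

/-- Central part of the even binomial row. -/
noncomputable def cc (M r : ℕ) : ℝ := ((2 * M).choose (M + r) : ℝ)

/-- Ballot numbers. -/
noncomputable def Ew (M r : ℕ) : ℝ := ww 1 (2 * M) (2 * (r : ℤ))

noncomputable def Wf (a : ℝ) (M r : ℕ) : ℝ := ww a (2 * M) (2 * (r : ℤ))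

noncomputable def Vf (a : ℝ) (M r : ℕ) : ℝ :=
  (M : ℝ) * (M + 1) * Wf a M r - 2 * M * (2 * M - 1) * Wf a (M - 1) r

lemma cc_succ (M r : ℕ) : ((M : ℝ) + r + 1) * cc M (r + 1) = ((M : ℝ) - r) * cc M r := by
  unfold cc
  rcases Nat.lt_or_ge M r with h | h
  · rw [Nat.choose_eq_zero_of_lt (by omega), Nat.choose_eq_zero_of_lt (by omega)]; simp
  · have := Nat.choose_succ_right_eq (2 * M) (M + r)
    have h2 : ((2 * M - (M + r) : ℕ) : ℝ) = (M : ℝ) - r := by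
      rw [Nat.cast_sub (by omega)]; push_cast; ring
    have h3 := congrArg (fun n : ℕ => (n : ℝ)) this
    simp only [Nat.cast_mul, h2] at h3
    push_cast at h3
    rw [← add_assoc M r 1]
    linarith

lemma cc_zero_of_lt (M r : ℕ) (h : M < r) : cc M r = 0 := by
  unfold cc
  rw [Nat.choose_eq_zero_of_lt (by omega)]; simp

lemma cc_up (M r : ℕ) :
    ((M : ℝ) + 1 - r) * ((M : ℝ) + 1 + r) * cc (M + 1) r
      = (2 * (M : ℝ) + 2) * (2 * M + 1) * cc M r := by
  rcases Nat.lt_or_ge M r with h | h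
  · rw [cc_zero_of_lt M r h]
    rcases Nat.lt_or_ge (M + 1) r with h' | h'
    · rw [cc_zero_of_lt _ r h']; simp
    · obtain rfl : r = M + 1 := by omega
      push_cast; ring
  · unfold cc
    have h1 := Nat.add_one_mul_choose_eq (2 * M + 1) (M + r)
    have h2 := Nat.choose_mul_succ_eq (2 * M) (M + r)
    have h3 : ((2 * M + 1 - (M + r) : ℕ) : ℝ) = (M : ℝ) + 1 - r := by
      rw [Nat.cast_sub (by omega)]; push_cast; ring
    have h1' := congrArg (fun n : ℕ => (n : ℝ)) h1
    have h2' := congrArg (fun n : ℕ => (n : ℝ)) h2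
    simp only [Nat.cast_mul, h3] at h1' h2'

    push_cast at h1' h2'
    rw [show 2 * (M + 1) = 2 * M + 1 + 1 by ring, show M + 1 + r = M + r + 1 by ring]
    linear_combination (-((M : ℝ) + 1 - r)) * h1' - (2 * (M : ℝ) + 2) * h2'

lemma Ew_eq (M r : ℕ) : Ew M r = (2 * (r : ℝ) + 1) / (M + r + 1) * cc M r := by
  have h := ww_one (2 * M) (M + r) (by omega)
  have e : 2 * ((M + r : ℕ) : ℤ) - ((2 * M : ℕ) : ℤ) = 2 * (r : ℤ) := by push_cast; ring
  rw [e] at h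
  have h1 : Ew M r = cc M r - cc M (r + 1) := h
  have h2 := cc_succ M r
  have h3 : ((M : ℝ) + r + 1) ≠ 0 := by positivity
  rw [h1, div_mul_eq_mul_div, eq_div_iff h3]
  linear_combination -h2

lemma ww_large (a : ℝ) (n : ℕ) : ∀ x : ℤ, (n : ℤ) < x → ww a n x = 0 := by
  induction n with
  | zero =>
    intro x hx
    have : x ≠ 0 := by rintro rfl; simp at hx
    simp [ww, this]
  | succ n ih =>
    intro x hx
    push_cast at hx
    rw [ww_succ_pos _ _ _ (by omega), ih _ (by omega), ih _ (by omega)]; simp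

lemma Wf_zero (a : ℝ) (M r : ℕ) (h : M < r) : Wf a M r = 0 :=
  ww_large _ _ _ (by push_cast; omega)

lemma Vf_zero (a : ℝ) (M r : ℕ) (h : M < r) : Vf a M r = 0 := by
  unfold Vf
  rw [Wf_zero a M r h, Wf_zero a (M - 1) r (by omega)]; ring

lemma Wf_rec (a : ℝ) (M r : ℕ) : Wf a M r = Ew M r + (a - 1) * Wf a M (r + 1) := by
  have := ww_ballot a (2 * M) (2 * (r : ℤ)) (by positivity)
  unfold Wf Ew
  rw [this]
  push_cast
  rw [mul_add]
  rfl

/-- `r (r+1) E(r)`. -/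
noncomputable def Gf (M r : ℕ) : ℝ := (r : ℝ) * (r + 1) * Ew M r

lemma Ew_pred (M r : ℕ) :
    2 * ((M : ℝ) + 1) * (2 * (M + 1) - 1) * Ew M r
      = ((M : ℝ) + 1) * (M + 2) * Ew (M + 1) r - Gf (M + 1) r := by
  unfold Gf
  rw [Ew_eq, Ew_eq]
  have h := cc_up M r
  have h1 : ((M : ℝ) + r + 1) ≠ 0 := by positivity
  have h2 : (((M + 1 : ℕ) : ℝ) + r + 1) ≠ 0 := by positivity
  push_cast at h2 ⊢
  field_simp
  linear_combination (-((M : ℝ) + 1 + r + 1)) * h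

lemma Vf_rec (a : ℝ) (M r : ℕ) (hM : 1 ≤ M) :
    Vf a M r = Gf M r + (a - 1) * Vf a M (r + 1) := by
  obtain ⟨m, rfl⟩ : ∃ m, M = m + 1 := ⟨M - 1, by omega⟩
  unfold Vf
  rw [Wf_rec a (m + 1) r, Nat.add_sub_cancel, Wf_rec a m r]
  have := Ew_pred m r
  push_cast
  linear_combination -this

lemma sum_range_even (f : ℕ → ℝ) (hf : ∀ i, f (2 * i + 1) = 0) (j : ℕ) :
    ∑ k ∈ Finset.range (2 * j + 1), f k = ∑ i ∈ Finset.range (j + 1), f (2 * i) := by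
  induction j with
  | zero => simp
  | succ j ih =>
    rw [show 2 * (j + 1) + 1 = 2 * j + 1 + 1 + 1 by ring, Finset.sum_range_succ,
      Finset.sum_range_succ, ih, hf, Finset.sum_range_succ _ (j + 1)]
    rw [show 2 * j + 1 + 1 = 2 * (j + 1) by ring]; ring

/-- The combination whose squares make up `PG1`. -/
noncomputable def Xf (a : ℝ) (M r : ℕ) : ℝ := Vf a M r * Wf a M 0 - Vf a M 0 * Wf a M r

lemma PG1_eq (a : ℝ) (j : ℕ) :
    PG1 (4 * j + 2) a 1 = (a / (2 * ((j : ℝ) + 1) * (2 * (j + 1) - 1))) ^ 2 *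
      ∑ r ∈ Finset.range (j + 1 + 1), (Xf a (j + 1) r) ^ 2 := by
  unfold PG1
  rw [show (4 * j + 2 - 2) / 2 = 2 * j by omega]
  simp only [one_pow, mul_one, sW_eq_ZZ]
  rw [sum_range_even]
  · rw [Finset.sum_range_succ' _ (j + 1)]
    have h0 : Xf a (j + 1) 0 = 0 := by unfold Xf; ring
    rw [h0]
    simp only [ne_eq, OfNat.ofNat_ne_zero, not_false_eq_true, zero_pow, add_zero]
    rw [Finset.mul_sum]
    apply Finset.sum_congr rfl
    intro i _
    rw [← mul_pow]
    congr 1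
    have he : Even (((2 * i : ℕ) : ℤ) + 2 - 0) := ⟨i + 1, by push_cast; ring⟩
    rw [ZZ_eq a (2 * j) 0 _ (by positivity) he]
    have e1 : (((2 * i : ℕ) : ℤ) + 2) = 2 * ((i + 1 : ℕ) : ℤ) := by push_cast; ring
    have w1 : ww a (2 * j) 0 = Wf a j 0 := by simp [Wf]
    have w2 : ww a (2 * j + 2) 0 = Wf a (j + 1) 0 := by simp [Wf, mul_add]
    have w3 : ww a (2 * j) (2 * ((i + 1 : ℕ) : ℤ)) = Wf a j (i + 1) := rfl
    have w4 : ww a (2 * j + 2) (2 * ((i + 1 : ℕ) : ℤ)) = Wf a (j + 1) (i + 1) := rfl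
    rw [e1, w1, w2, w3, w4]
    unfold Xf Vf
    rw [Nat.add_sub_cancel]
    push_cast
    have hj : (2 * ((j : ℝ) + 1) - 1) ≠ 0 := by
      have : (0 : ℝ) ≤ j := by positivity
      linarith
    have hj2 : ((j : ℝ) + 1) ≠ 0 := by positivity
    field_simp
    ring
  · intro i
    rw [ZZ_odd]
    · norm_num
    · rintro ⟨d, hd⟩
      push_cast at hd
      omega

/-! ### Part 3: moments of the squared binomial row -/

noncomputable def HH (p M : ℕ) : ℝ := ∑ r ∈ Finset.range (M + 1), (r : ℝ) ^ (2 * p) * cc M r ^ 2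

noncomputable def QQ (M : ℕ) : ℝ := ((2 * M).centralBinom : ℝ)

lemma QQ_pos (M : ℕ) : 0 < QQ M := by
  unfold QQ; exact_mod_cast Nat.centralBinom_pos _

lemma tel (M : ℕ) (p : ℝ → ℝ) :
    ∑ r ∈ Finset.range (M + 1),
      (p r * ((M : ℝ) + r) ^ 2 - p (r + 1) * ((M : ℝ) - r) ^ 2) * cc M r ^ 2
      = p 0 * (M : ℝ) ^ 2 * cc M 0 ^ 2 := by
  have h : ∀ r : ℕ, (p r * ((M : ℝ) + r) ^ 2 - p (r + 1) * ((M : ℝ) - r) ^ 2) * cc M r ^ 2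
      = (fun r : ℕ => p r * ((M : ℝ) + r) ^ 2 * cc M r ^ 2) r
        - (fun r : ℕ => p r * ((M : ℝ) + r) ^ 2 * cc M r ^ 2) (r + 1) := by
    intro r
    have := cc_succ M r
    simp only
    push_cast
    have e : ((M : ℝ) + (r + 1)) ^ 2 * cc M (r + 1) ^ 2 = (((M : ℝ) - r) * cc M r) ^ 2 := by
      rw [← this]; ring
    linear_combination p (r + 1) * e
  rw [Finset.sum_congr rfl (fun r _ => h r), Finset.sum_range_sub']
  simp only [cc_zero_of_lt M (M + 1) (Nat.lt_succ_self M)]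
  simp

lemma HH_zero (M : ℕ) : 2 * HH 0 M = QQ M + cc M 0 ^ 2 := by
  have h := Nat.sum_range_choose_sq (2 * M)
  have h' : ∑ i ∈ Finset.range (2 * M + 1), ((2 * M).choose i : ℝ) ^ 2 = QQ M := by
    unfold QQ
    rw [Nat.centralBinom_eq_two_mul_choose, ← h]
    push_cast; rfl
  rw [show 2 * M + 1 = M + (M + 1) by ring, Finset.sum_range_add,
    ← Finset.sum_range_reflect] at h'
  have e1 : ∑ x ∈ Finset.range (M + 1), ((2 * M).choose (M + x) : ℝ) ^ 2 = HH 0 M := by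
    unfold HH cc; simp
  have e2 : ∑ x ∈ Finset.range M, ((2 * M).choose (M - 1 - x) : ℝ) ^ 2
      = ∑ x ∈ Finset.range M, cc M (x + 1) ^ 2 := by
    apply Finset.sum_congr rfl
    intro x hx
    have hx := Finset.mem_range.mp hx
    unfold cc
    congr 2
    rw [← Nat.choose_symm (by omega : M + (x + 1) ≤ 2 * M)]
    congr 1; omega
  have e3 : HH 0 M = ∑ x ∈ Finset.range M, cc M (x + 1) ^ 2 + cc M 0 ^ 2 := by
    unfold HH
    rw [Finset.sum_range_succ']; simp
  rw [e1, e2] at h'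
  linarith

lemma HH_zero_le (M : ℕ) : HH 0 M ≤ QQ M := by
  have h := HH_zero M
  have : cc M 0 ^ 2 ≤ HH 0 M := by
    unfold HH
    have := Finset.single_le_sum (f := fun r : ℕ => (r : ℝ) ^ (2 * 0) * cc M r ^ 2)
      (fun i _ => by positivity) (Finset.mem_range.2 (Nat.succ_pos M))
    simpa using this
  linarith

lemma HH_nonneg (p M : ℕ) : 0 ≤ HH p M := by
  unfold HH
  exact Finset.sum_nonneg fun r _ => mul_nonneg (by rw [pow_mul]; positivity) (sq_nonneg _)

lemma HH_one (M : ℕ) : (4 * (M : ℝ) - 1) * HH 1 M = (M : ℝ) ^ 2 * QQ M / 2 := by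
  have h := tel M (fun r => r - 1 / 2)
  have h0 := HH_zero M
  have : (4 * (M : ℝ) - 1) * HH 1 M - (M : ℝ) ^ 2 * HH 0 M
      = (0 - 1 / 2) * (M : ℝ) ^ 2 * cc M 0 ^ 2 := by
    rw [← h]
    unfold HH
    rw [Finset.mul_sum, Finset.mul_sum, ← Finset.sum_sub_distrib]
    exact Finset.sum_congr rfl fun r _ => by ring
  linear_combination this + (M : ℝ) ^ 2 / 2 * h0

lemma HH_two (M : ℕ) : (4 * (M : ℝ) - 3) * HH 2 M = (3 * (M : ℝ) ^ 2 - 2 * M) * HH 1 M := by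
  have h := tel M (fun r => r * (r - 1) * (r - 1 / 2))
  have : (4 * (M : ℝ) - 3) * HH 2 M - (3 * (M : ℝ) ^ 2 - 2 * M) * HH 1 M
      = (0 * (0 - 1) * (0 - 1 / 2)) * (M : ℝ) ^ 2 * cc M 0 ^ 2 := by
    rw [← h]
    unfold HH
    rw [Finset.mul_sum, Finset.mul_sum, ← Finset.sum_sub_distrib]
    exact Finset.sum_congr rfl fun r _ => by ring
  linear_combination this

lemma HH_three (M : ℕ) : (4 * (M : ℝ) - 5) * HH 3 M
    = (5 * (M : ℝ) ^ 2 - 8 * M + 1) * HH 2 M + (M : ℝ) ^ 2 * HH 1 M := by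
  have h := tel M (fun r => r ^ 2 * (r - 1) ^ 2 * (r - 1 / 2))
  have : (4 * (M : ℝ) - 5) * HH 3 M - (5 * (M : ℝ) ^ 2 - 8 * M + 1) * HH 2 M
      - (M : ℝ) ^ 2 * HH 1 M
      = (0 ^ 2 * (0 - 1) ^ 2 * (0 - 1 / 2)) * (M : ℝ) ^ 2 * cc M 0 ^ 2 := by
    rw [← h]
    unfold HH
    rw [Finset.mul_sum, Finset.mul_sum, Finset.mul_sum, ← Finset.sum_sub_distrib,
      ← Finset.sum_sub_distrib]
    exact Finset.sum_congr rfl fun r _ => by ring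
  linear_combination this

lemma HH_four (M : ℕ) : (4 * (M : ℝ) - 7) * HH 4 M
    = (7 * (M : ℝ) ^ 2 - 18 * M + 5) * HH 3 M + (5 * (M : ℝ) ^ 2 - 2 * M) * HH 2 M := by
  have h := tel M (fun r => r ^ 3 * (r - 1) ^ 3 * (r - 1 / 2))
  have : (4 * (M : ℝ) - 7) * HH 4 M - (7 * (M : ℝ) ^ 2 - 18 * M + 5) * HH 3 M
      - (5 * (M : ℝ) ^ 2 - 2 * M) * HH 2 M
      = (0 ^ 3 * (0 - 1) ^ 3 * (0 - 1 / 2)) * (M : ℝ) ^ 2 * cc M 0 ^ 2 := by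
    rw [← h]
    unfold HH
    rw [Finset.mul_sum, Finset.mul_sum, Finset.mul_sum, ← Finset.sum_sub_distrib,
      ← Finset.sum_sub_distrib]
    exact Finset.sum_congr rfl fun r _ => by ring
  linear_combination this

lemma invlim : Tendsto (fun M : ℕ => ((M : ℝ))⁻¹) atTop (nhds 0) :=
  tendsto_inv_atTop_zero.comp tendsto_natCast_atTop_atTop

/-- Limits of functions of `1/M`. -/
lemma ratlim (f : ℝ → ℝ) (c : ℝ) (hf : ContinuousAt f 0) (hc : f 0 = c) (g : ℕ → ℝ)
    (hg : ∀ M : ℕ, 10 ≤ M → g M = f ((M : ℝ))⁻¹) : Tendsto g atTop (nhds c) := by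
  have h : Tendsto (fun M : ℕ => f ((M : ℝ))⁻¹) atTop (nhds (f 0)) := hf.tendsto.comp invlim
  rw [hc] at h
  refine h.congr' ?_
  filter_upwards [eventually_ge_atTop 10] with M hM
  exact (hg M hM).symm

lemma cast_ten {M : ℕ} (hM : 10 ≤ M) : (10 : ℝ) ≤ M := by exact_mod_cast hM

lemma lim_HH1 : Tendsto (fun M : ℕ => HH 1 M / ((M : ℝ) * QQ M)) atTop (nhds (1 / 8)) := by
  apply ratlim (fun x => 1 / (2 * (4 - x)))
  · exact ContinuousAt.div (by fun_prop) (by fun_prop) (by norm_num)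
  · norm_num
  intro M hM
  have hM := cast_ten hM
  have hQ := (QQ_pos M).ne'
  have h := HH_one M
  have h4 : 4 * (M : ℝ) - 1 ≠ 0 := by linarith
  have h5 : 4 - (M : ℝ)⁻¹ = (4 * M - 1) / M := by field_simp
  rw [h5]
  have h' : HH 1 M = ((M : ℝ) ^ 2 * QQ M / 2) / (4 * M - 1) := by
    rw [eq_div_iff h4]; linear_combination h
  rw [h']
  field_simp

lemma lim_HH2 : Tendsto (fun M : ℕ => HH 2 M / ((M : ℝ) ^ 2 * QQ M)) atTop (nhds (3 / 32)) := by
  have h1 : Tendsto (fun M : ℕ => (3 * (M : ℝ) ^ 2 - 2 * M) / (M * (4 * M - 3)))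
      atTop (nhds (3 / 4)) := by
    apply ratlim (fun x => (3 - 2 * x) / (4 - 3 * x))
    · exact ContinuousAt.div (by fun_prop) (by fun_prop) (by norm_num)
    · norm_num
    intro M hM
    have hM := cast_ten hM
    have h4 : 4 * (M : ℝ) - 3 ≠ 0 := by linarith
    have h5 : 4 - 3 * (M : ℝ)⁻¹ = (4 * M - 3) / M := by field_simp
    rw [h5]
    field_simp
  have h := h1.mul lim_HH1
  rw [show (3 : ℝ) / 4 * (1 / 8) = 3 / 32 by norm_num] at h
  refine h.congr' ?_
  filter_upwards [eventually_ge_atTop 10] with M hM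
  have hM := cast_ten hM
  have hQ := (QQ_pos M).ne'
  have h4 : 4 * (M : ℝ) - 3 ≠ 0 := by linarith
  have h := HH_two M
  have h' : HH 2 M = ((3 * (M : ℝ) ^ 2 - 2 * M) * HH 1 M)
      / (4 * M - 3) := by
    rw [eq_div_iff h4]; linear_combination h
  rw [h']
  field_simp

lemma lim_HH3 : Tendsto (fun M : ℕ => HH 3 M / ((M : ℝ) ^ 3 * QQ M)) atTop
    (nhds (15 / 128)) := by
  have h1 : Tendsto (fun M : ℕ => (5 * (M : ℝ) ^ 2 - 8 * M + 1) / (M * (4 * M - 5)))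
      atTop (nhds (5 / 4)) := by
    apply ratlim (fun x => (5 - 8 * x + x ^ 2) / (4 - 5 * x))
    · exact ContinuousAt.div (by fun_prop) (by fun_prop) (by norm_num)
    · norm_num
    intro M hM
    have hM := cast_ten hM
    have h4 : 4 * (M : ℝ) - 5 ≠ 0 := by linarith
    have h5 : 4 - 5 * (M : ℝ)⁻¹ = (4 * M - 5) / M := by field_simp
    rw [h5]
    field_simp
  have h2 : Tendsto (fun M : ℕ => (1 : ℝ) / (4 * M - 5)) atTop (nhds 0) := by
    apply ratlim (fun x => x / (4 - 5 * x))
    · exact ContinuousAt.div (by fun_prop) (by fun_prop) (by norm_num)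
    · norm_num
    intro M hM
    have hM := cast_ten hM
    have h4 : 4 * (M : ℝ) - 5 ≠ 0 := by linarith
    have h5 : 4 - 5 * (M : ℝ)⁻¹ = (4 * M - 5) / M := by field_simp
    rw [h5]
    field_simp
  have h := (h1.mul lim_HH2).add (h2.mul lim_HH1)
  rw [show (5 : ℝ) / 4 * (3 / 32) + 0 * (1 / 8) = 15 / 128 by norm_num] at h
  refine h.congr' ?_
  filter_upwards [eventually_ge_atTop 10] with M hM
  have hM := cast_ten hM
  have hQ := (QQ_pos M).ne'
  have h4 : 4 * (M : ℝ) - 5 ≠ 0 := by linarith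
  have h := HH_three M
  have h' : HH 3 M = ((5 * (M : ℝ) ^ 2 - 8 * M + 1) * HH 2 M + (M : ℝ) ^ 2 * HH 1 M)
      / (4 * M - 5) := by
    rw [eq_div_iff h4]; linear_combination h
  rw [h']
  field_simp

lemma lim_HH4 : Tendsto (fun M : ℕ => HH 4 M / ((M : ℝ) ^ 4 * QQ M)) atTop
    (nhds (105 / 512)) := by
  have h1 : Tendsto (fun M : ℕ => (7 * (M : ℝ) ^ 2 - 18 * M + 5) / (M * (4 * M - 7)))
      atTop (nhds (7 / 4)) := by
    apply ratlim (fun x => (7 - 18 * x + 5 * x ^ 2) / (4 - 7 * x))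
    · exact ContinuousAt.div (by fun_prop) (by fun_prop) (by norm_num)
    · norm_num
    intro M hM
    have hM := cast_ten hM
    have h4 : 4 * (M : ℝ) - 7 ≠ 0 := by linarith
    have h5 : 4 - 7 * (M : ℝ)⁻¹ = (4 * M - 7) / M := by field_simp
    rw [h5]
    field_simp
  have h2 : Tendsto (fun M : ℕ => (5 * (M : ℝ) ^ 2 - 2 * M) / (M ^ 2 * (4 * M - 7)))
      atTop (nhds 0) := by
    apply ratlim (fun x => (5 - 2 * x) * x / (4 - 7 * x))
    · exact ContinuousAt.div (by fun_prop) (by fun_prop) (by norm_num)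
    · norm_num
    intro M hM
    have hM := cast_ten hM
    have h4 : 4 * (M : ℝ) - 7 ≠ 0 := by linarith
    have h5 : 4 - 7 * (M : ℝ)⁻¹ = (4 * M - 7) / M := by field_simp
    rw [h5]
    field_simp
  have h := (h1.mul lim_HH3).add (h2.mul lim_HH2)
  rw [show (7 : ℝ) / 4 * (15 / 128) + 0 * (3 / 32) = 105 / 512 by norm_num] at h
  refine h.congr' ?_
  filter_upwards [eventually_ge_atTop 10] with M hM
  have hM := cast_ten hM
  have hQ := (QQ_pos M).ne'
  have h4 : 4 * (M : ℝ) - 7 ≠ 0 := by linarith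
  have h := HH_four M
  have h' : HH 4 M = ((7 * (M : ℝ) ^ 2 - 18 * M + 5) * HH 3 M + (5 * (M : ℝ) ^ 2 - 2 * M) * HH 2 M)
      / (4 * M - 7) := by
    rw [eq_div_iff h4]; linear_combination h
  rw [h']
  field_simp

/-- The error scale: everything of this size is negligible. -/
lemma lim_err : Tendsto (fun M : ℕ => (((M : ℝ) ^ 2 * HH 2 M + (M : ℝ) ^ 2 * HH 0 M + HH 4 M
    + HH 0 M + (M : ℝ) ^ 2 * HH 1 M) / (M : ℝ) ^ 4) / (M * QQ M)) atTop (nhds 0) := by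
  have hb : ∀ M : ℕ, 10 ≤ M →
      (((M : ℝ) ^ 2 * HH 2 M + (M : ℝ) ^ 2 * HH 0 M + HH 4 M
        + HH 0 M + (M : ℝ) ^ 2 * HH 1 M) / (M : ℝ) ^ 4) / (M * QQ M)
      ≤ (M : ℝ)⁻¹ * (HH 2 M / ((M : ℝ) ^ 2 * QQ M) + HH 4 M / ((M : ℝ) ^ 4 * QQ M)
        + HH 1 M / ((M : ℝ) * QQ M) + 2) := by
    intro M hM
    have hM := cast_ten hM
    have hQ := QQ_pos M
    have h0 := HH_zero_le M
    have h1 := HH_nonneg 1 M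
    have e : (M : ℝ)⁻¹ * (HH 2 M / ((M : ℝ) ^ 2 * QQ M) + HH 4 M / ((M : ℝ) ^ 4 * QQ M)
        + HH 1 M / ((M : ℝ) * QQ M) + 2)
        = (((M : ℝ) ^ 2 * HH 2 M + HH 4 M + (M : ℝ) ^ 3 * HH 1 M + 2 * (M : ℝ) ^ 4 * QQ M)
          / (M : ℝ) ^ 4) / (M * QQ M) := by
      field_simp
    rw [e]
    gcongr ?_ / _ / _
    have a1 : (M : ℝ) ^ 2 * HH 0 M ≤ (M : ℝ) ^ 4 * QQ M := by
      have : (M : ℝ) ^ 2 ≤ (M : ℝ) ^ 4 := pow_le_pow_right₀ (by linarith) (by norm_num)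
      exact mul_le_mul this h0 (HH_nonneg _ _) (by positivity)
    have a2 : HH 0 M ≤ (M : ℝ) ^ 4 * QQ M := by
      have : (1 : ℝ) ≤ (M : ℝ) ^ 4 := one_le_pow₀ (by linarith)
      nlinarith
    have a3 : (M : ℝ) ^ 2 * HH 1 M ≤ (M : ℝ) ^ 3 * HH 1 M :=
      mul_le_mul_of_nonneg_right (pow_le_pow_right₀ (by linarith) (by norm_num)) h1
    linarith
  have hl := invlim.mul (((lim_HH2.add lim_HH4).add lim_HH1).add_const 2)
  rw [zero_mul] at hl
  refine tendsto_of_tendsto_of_tendsto_of_le_of_le' tendsto_const_nhds hl ?_ ?_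
  · filter_upwards with M
    have := HH_nonneg 0 M
    have := HH_nonneg 1 M
    have := HH_nonneg 2 M
    have := HH_nonneg 4 M
    have := QQ_pos M
    positivity
  · filter_upwards [eventually_ge_atTop 10] with M hM
    exact hb M hM

/-! ### Part 4: square-sum estimates -/

noncomputable def N2 (M : ℕ) (f : ℕ → ℝ) : ℝ := ∑ r ∈ Finset.range (M + 1), f r ^ 2

lemma N2_nonneg (M : ℕ) (f : ℕ → ℝ) : 0 ≤ N2 M f := Finset.sum_nonneg fun _ _ => sq_nonneg _

lemma N2_perturb (f e : ℕ → ℕ → ℝ) (c : ℕ → ℝ) (hc : ∀ M, 0 ≤ c M) (L : ℝ)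
    (hf : Tendsto (fun M => N2 M (f M) / c M) atTop (nhds L))
    (he : Tendsto (fun M => N2 M (e M) / c M) atTop (nhds 0)) :
    Tendsto (fun M => N2 M (fun r => f M r + e M r) / c M) atTop (nhds L) := by
  have hcross : Tendsto (fun M => (∑ r ∈ Finset.range (M + 1), f M r * e M r) / c M)
      atTop (nhds 0) := by
    have hl := (hf.sqrt).mul (he.sqrt)
    rw [Real.sqrt_zero, mul_zero] at hl
    refine squeeze_zero_norm (fun M => ?_) hl
    rw [Real.norm_eq_abs, abs_div, abs_of_nonneg (hc M),
      Real.sqrt_div (N2_nonneg _ _), Real.sqrt_div (N2_nonneg _ _), div_mul_div_comm,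
      Real.mul_self_sqrt (hc M), ← Real.sqrt_mul (N2_nonneg _ _)]
    refine div_le_div_of_nonneg_right ?_ (hc M)
    exact Real.abs_le_sqrt (Finset.sum_mul_sq_le_sq_mul_sq _ _ _)
  have h := (hf.add (hcross.const_mul 2)).add he
  rw [mul_zero, add_zero, add_zero] at h
  refine h.congr fun M => ?_
  have : N2 M (fun r => f M r + e M r)
      = N2 M (f M) + 2 * (∑ r ∈ Finset.range (M + 1), f M r * e M r) + N2 M (e M) := by
    unfold N2
    rw [Finset.mul_sum, ← Finset.sum_add_distrib, ← Finset.sum_add_distrib]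
    exact Finset.sum_congr rfl fun r _ => by ring
  rw [this]; ring

lemma N2_mul (M : ℕ) (k : ℝ) (f : ℕ → ℝ) : N2 M (fun r => k * f r) = k ^ 2 * N2 M f := by
  unfold N2
  rw [Finset.mul_sum]
  exact Finset.sum_congr rfl fun r _ => by ring

lemma N2_scale (f : ℕ → ℕ → ℝ) (κ c : ℕ → ℝ) (k L : ℝ)
    (hk : Tendsto κ atTop (nhds k))
    (hf : Tendsto (fun M => N2 M (f M) / c M) atTop (nhds L)) :
    Tendsto (fun M => N2 M (fun r => κ M * f M r) / c M) atTop (nhds (k ^ 2 * L)) := by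
  refine ((hk.pow 2).mul hf).congr fun M => ?_
  rw [N2_mul]; ring

lemma N2_shift (M : ℕ) (b : ℝ) (hb : |b| < 1) (D g : ℕ → ℝ) (hD : D (M + 1) = 0)
    (hr : ∀ r, D r = g r + b * D (r + 1)) : N2 M D ≤ N2 M g / (1 - |b|) ^ 2 := by
  have hb' : 0 < 1 - |b| := by linarith
  have hpt : ∀ r, D r ^ 2 ≤ g r ^ 2 / (1 - |b|) + |b| * D (r + 1) ^ 2 := by
    intro r
    have h1 : D r ^ 2 ≤ (|g r| + |b| * |D (r + 1)|) ^ 2 := by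
      rw [← sq_abs (D r), hr r]
      have := abs_add_le (g r) (b * D (r + 1))
      rw [abs_mul] at this
      exact pow_le_pow_left₀ (abs_nonneg _) this 2
    refine h1.trans ?_
    rw [← sq_abs (g r), ← sq_abs (D (r + 1)), div_add' _ _ _ hb'.ne', le_div_iff₀ hb']
    have hb0 := abs_nonneg b
    nlinarith [mul_nonneg hb0 (sq_nonneg (|g r| - (1 - |b|) * |D (r + 1)|))]
  have hs : N2 M D ≤ N2 M g / (1 - |b|) + |b| * N2 M D := by
    have h1 : N2 M D ≤ N2 M g / (1 - |b|) + |b| * ∑ r ∈ Finset.range (M + 1), D (r + 1) ^ 2 := by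
      unfold N2
      rw [Finset.mul_sum, Finset.sum_div, ← Finset.sum_add_distrib]
      exact Finset.sum_le_sum fun r _ => hpt r
    have h2 : ∑ r ∈ Finset.range (M + 1), D (r + 1) ^ 2 ≤ N2 M D := by
      unfold N2
      rw [Finset.sum_range_succ, hD, Finset.sum_range_succ' (fun r => D r ^ 2)]
      have := sq_nonneg (D 0)
      simp only [ne_eq, OfNat.ofNat_ne_zero, not_false_eq_true, zero_pow]
      linarith
    exact h1.trans (by gcongr)
  rw [le_div_iff₀ (by positivity)]
  have h3 : N2 M D * (1 - |b|) ≤ N2 M g / (1 - |b|) := by linarith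
  rw [le_div_iff₀ hb'] at h3
  linarith

/-- The error scale. -/
noncomputable def er (M : ℕ) : ℝ := ((M : ℝ) ^ 2 * HH 2 M + (M : ℝ) ^ 2 * HH 0 M + HH 4 M
    + HH 0 M + (M : ℝ) ^ 2 * HH 1 M) / (M : ℝ) ^ 4

noncomputable def cn (M : ℕ) : ℝ := (M : ℝ) * QQ M

lemma cn_nonneg (M : ℕ) : 0 ≤ cn M := mul_nonneg (by positivity) (QQ_pos M).le

lemma N2_le_er (M : ℕ) (f : ℕ → ℝ) (K : ℝ)
    (h : ∀ r : ℕ, f r ^ 2 ≤ K * (((M : ℝ) ^ 2 * (r : ℝ) ^ 4 + (M : ℝ) ^ 2 + (r : ℝ) ^ 8 + 1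
      + (M : ℝ) ^ 2 * (r : ℝ) ^ 2) * cc M r ^ 2 / (M : ℝ) ^ 4)) : N2 M f ≤ K * er M := by
  unfold N2 er HH
  refine (Finset.sum_le_sum fun r _ => h r).trans (le_of_eq ?_)
  rw [← Finset.mul_sum, ← Finset.sum_div]
  congr 2
  simp only [Finset.mul_sum, ← Finset.sum_add_distrib]
  exact Finset.sum_congr rfl fun r _ => by ring

lemma small_of_le (F : ℕ → ℝ) (K : ℝ) (h0 : ∀ M, 0 ≤ F M)
    (h : ∀ M : ℕ, 10 ≤ M → F M ≤ K * er M) :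
    Tendsto (fun M => F M / cn M) atTop (nhds 0) := by
  have hl : Tendsto (fun M => K * (er M / cn M)) atTop (nhds 0) := by
    have := lim_err.const_mul K
    rw [mul_zero] at this
    exact this
  refine tendsto_of_tendsto_of_tendsto_of_le_of_le' tendsto_const_nhds hl ?_ ?_
  · filter_upwards with M
    exact div_nonneg (h0 M) (cn_nonneg M)
  · filter_upwards [eventually_ge_atTop 10] with M hM
    rw [← mul_div_assoc]
    exact div_le_div_of_nonneg_right (h M hM) (cn_nonneg M)

lemma E_bound (M : ℕ) (hM : 10 ≤ M) : N2 M (Ew M) ≤ 8 * er M := by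
  apply N2_le_er
  intro r
  have hM := cast_ten hM
  have hr : (0 : ℝ) ≤ r := by positivity
  rw [Ew_eq, mul_pow, div_pow, ← mul_div_assoc, div_mul_eq_mul_div]
  rw [div_le_div_iff₀ (by positivity) (by positivity)]
  have h1 : (2 * (r : ℝ) + 1) ^ 2 * (M : ℝ) ^ 2 ≤ 8 * ((M : ℝ) ^ 2 * (r : ℝ) ^ 4 + (M : ℝ) ^ 2
      + (r : ℝ) ^ 8 + 1 + (M : ℝ) ^ 2 * (r : ℝ) ^ 2) := by
    have : (2 * (r : ℝ) + 1) ^ 2 ≤ 8 * (r : ℝ) ^ 2 + 8 := by nlinarith [sq_nonneg ((r : ℝ) - 1)]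
    have h2 := mul_le_mul_of_nonneg_right this (sq_nonneg (M : ℝ))
    have h3 : (0 : ℝ) ≤ (M : ℝ) ^ 2 * (r : ℝ) ^ 4 := by positivity
    have h4 : (0 : ℝ) ≤ (r : ℝ) ^ 8 := by positivity
    linarith
  have h2 : (M : ℝ) ^ 2 ≤ ((M : ℝ) + r + 1) ^ 2 := by gcongr; linarith
  calc (2 * (r : ℝ) + 1) ^ 2 * cc M r ^ 2 * (M : ℝ) ^ 4
      = ((2 * (r : ℝ) + 1) ^ 2 * (M : ℝ) ^ 2) * cc M r ^ 2 * (M : ℝ) ^ 2 := by ring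
    _ ≤ (8 * ((M : ℝ) ^ 2 * (r : ℝ) ^ 4 + (M : ℝ) ^ 2
      + (r : ℝ) ^ 8 + 1 + (M : ℝ) ^ 2 * (r : ℝ) ^ 2)) * cc M r ^ 2 * ((M : ℝ) + r + 1) ^ 2 := by
        gcongr
    _ = _ := by ring

/-- Leading part of `Gf`. -/
noncomputable def G0 (M r : ℕ) : ℝ := 2 * (r : ℝ) ^ 3 / M * cc M r

lemma sq_le_of_abs_le_two {x y z : ℝ} (h : |x| ≤ y + z) : x ^ 2 ≤ 2 * y ^ 2 + 2 * z ^ 2 := by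
  have h1 : x ^ 2 ≤ (y + z) ^ 2 := by
    rw [← sq_abs x]; exact pow_le_pow_left₀ (abs_nonneg _) h 2
  nlinarith [sq_nonneg (y - z)]

lemma e1_bound (M : ℕ) (hM : 10 ≤ M) : N2 M (fun r => Gf M r - G0 M r) ≤ 32 * er M := by
  apply N2_le_er
  intro r
  have hM := cast_ten hM
  have hr : (0 : ℝ) ≤ r := by positivity
  have hr1 : (r : ℝ) ≤ (r : ℝ) ^ 2 := by
    have : (r : ℕ) ≤ r ^ 2 := Nat.le_self_pow (by norm_num) r
    exact_mod_cast this
  have hr3 : (r : ℝ) ^ 3 ≤ (r : ℝ) ^ 4 := by nlinarith [sq_nonneg (r : ℝ)]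
  have e : Gf M r - G0 M r
      = ((M : ℝ) * (3 * (r : ℝ) ^ 2 + r) - 2 * (r : ℝ) ^ 3 * (r + 1)) / (M * (M + r + 1))
        * cc M r := by
    unfold Gf G0
    rw [Ew_eq]
    field_simp
    ring
  rw [e, mul_pow, div_pow]
  have hn : ((M : ℝ) * (3 * (r : ℝ) ^ 2 + r) - 2 * (r : ℝ) ^ 3 * (r + 1)) ^ 2
      ≤ 2 * (4 * (M * (r : ℝ) ^ 2)) ^ 2 + 2 * (4 * (r : ℝ) ^ 4) ^ 2 := by
    apply sq_le_of_abs_le_two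
    have p1 : (M : ℝ) * r ≤ M * (r : ℝ) ^ 2 := by gcongr
    have p2 : 0 ≤ (M : ℝ) * (r : ℝ) ^ 2 := by positivity
    have p3 : 0 ≤ (M : ℝ) * r := by positivity
    have p4 : (0 : ℝ) ≤ (r : ℝ) ^ 4 := by positivity
    have p5 : (0 : ℝ) ≤ (r : ℝ) ^ 3 := by positivity
    rw [abs_le]
    constructor <;> nlinarith
  have hd : (M : ℝ) ^ 4 ≤ ((M : ℝ) * (M + r + 1)) ^ 2 := by
    have : (M : ℝ) ^ 2 ≤ (M : ℝ) * (M + r + 1) := by nlinarith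
    calc (M : ℝ) ^ 4 = ((M : ℝ) ^ 2) ^ 2 := by ring
      _ ≤ _ := by gcongr
  calc ((M : ℝ) * (3 * (r : ℝ) ^ 2 + r) - 2 * (r : ℝ) ^ 3 * (r + 1)) ^ 2
        / ((M : ℝ) * (M + r + 1)) ^ 2 * cc M r ^ 2
      ≤ (2 * (4 * (M * (r : ℝ) ^ 2)) ^ 2 + 2 * (4 * (r : ℝ) ^ 4) ^ 2) / (M : ℝ) ^ 4
        * cc M r ^ 2 := by gcongr
    _ = 32 * (((M : ℝ) ^ 2 * (r : ℝ) ^ 4 + (r : ℝ) ^ 8) * cc M r ^ 2 / (M : ℝ) ^ 4) := by ring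
    _ ≤ _ := by
      gcongr 32 * (?_ * _ / _)
      have p1 : (0 : ℝ) ≤ (M : ℝ) ^ 2 := by positivity
      have p2 : (0 : ℝ) ≤ (M : ℝ) ^ 2 * (r : ℝ) ^ 2 := by positivity
      linarith

lemma DG_bound (M : ℕ) (hM : 10 ≤ M) :
    N2 M (fun r => Gf M (r + 1) - Gf M r) ≤ 4096 * er M := by
  apply N2_le_er
  intro r
  have hM := cast_ten hM
  have hr : (0 : ℝ) ≤ r := by positivity
  have e : Gf M (r + 1) - Gf M r
      = ((r : ℝ) + 1) ^ 2 * (6 * M - 4 * r * (r + 2)) / ((M + r + 1) * (M + r + 2))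
        * cc M r := by
    unfold Gf
    rw [Ew_eq, Ew_eq]
    have hcc : cc M (r + 1) = ((M : ℝ) - r) * cc M r / (M + r + 1) := by
      rw [eq_div_iff (by positivity)]; linear_combination cc_succ M r
    rw [hcc]
    push_cast
    have h2 : (M : ℝ) + (r + 1) + 1 = M + r + 2 := by ring
    rw [h2]
    field_simp
    ring
  rw [e, mul_pow, div_pow]
  have hn : (((r : ℝ) + 1) ^ 2 * (6 * M - 4 * r * (r + 2))) ^ 2
      ≤ 2 * (6 * M * ((r : ℝ) + 1) ^ 2) ^ 2 + 2 * (4 * ((r : ℝ) + 1) ^ 4) ^ 2 := by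
    apply sq_le_of_abs_le_two
    rw [abs_mul, abs_of_nonneg (sq_nonneg ((r : ℝ) + 1))]
    have : |6 * (M : ℝ) - 4 * r * (r + 2)| ≤ 6 * M + 4 * ((r : ℝ) + 1) ^ 2 := by
      rw [abs_le]
      constructor <;> nlinarith
    calc ((r : ℝ) + 1) ^ 2 * |6 * (M : ℝ) - 4 * r * (r + 2)|
        ≤ ((r : ℝ) + 1) ^ 2 * (6 * M + 4 * ((r : ℝ) + 1) ^ 2) := by gcongr
      _ = _ := by ring
  have h4 : ((r : ℝ) + 1) ^ 4 ≤ 8 * ((r : ℝ) ^ 4 + 1) := by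
    nlinarith [sq_nonneg ((r : ℝ) - 1), sq_nonneg ((r : ℝ) ^ 2 - 1), sq_nonneg ((r : ℝ) + 1),
      mul_nonneg hr (sq_nonneg ((r : ℝ) - 1)), sq_nonneg ((r : ℝ) ^ 2 - r)]
  have h8 : ((r : ℝ) + 1) ^ 8 ≤ 128 * ((r : ℝ) ^ 8 + 1) := by
    calc ((r : ℝ) + 1) ^ 8 = (((r : ℝ) + 1) ^ 4) ^ 2 := by ring
      _ ≤ (8 * ((r : ℝ) ^ 4 + 1)) ^ 2 := by gcongr
      _ ≤ _ := by nlinarith [sq_nonneg ((r : ℝ) ^ 4 - 1)]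
  have hd : (M : ℝ) ^ 4 ≤ (((M : ℝ) + r + 1) * (M + r + 2)) ^ 2 := by
    have : (M : ℝ) ^ 2 ≤ ((M : ℝ) + r + 1) * (M + r + 2) := by nlinarith
    calc (M : ℝ) ^ 4 = ((M : ℝ) ^ 2) ^ 2 := by ring
      _ ≤ _ := by gcongr
  have hn2 : 2 * (6 * M * ((r : ℝ) + 1) ^ 2) ^ 2 + 2 * (4 * ((r : ℝ) + 1) ^ 4) ^ 2
      ≤ 4096 * ((M : ℝ) ^ 2 * (r : ℝ) ^ 4 + (M : ℝ) ^ 2 + (r : ℝ) ^ 8 + 1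
      + (M : ℝ) ^ 2 * (r : ℝ) ^ 2) := by
    have p0 := mul_le_mul_of_nonneg_left h4 (sq_nonneg (M : ℝ))
    have p1 : (0 : ℝ) ≤ (M : ℝ) ^ 2 := by positivity
    have p2 : (0 : ℝ) ≤ (M : ℝ) ^ 2 * (r : ℝ) ^ 2 := by positivity
    have p3 : (0 : ℝ) ≤ (M : ℝ) ^ 2 * (r : ℝ) ^ 4 := by positivity
    have e1 : 2 * (6 * M * ((r : ℝ) + 1) ^ 2) ^ 2 + 2 * (4 * ((r : ℝ) + 1) ^ 4) ^ 2
      = 72 * ((M : ℝ) ^ 2 * ((r : ℝ) + 1) ^ 4) + 32 * ((r : ℝ) + 1) ^ 8 := by ring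
    rw [e1]
    linarith
  calc (((r : ℝ) + 1) ^ 2 * (6 * M - 4 * r * (r + 2))) ^ 2
        / (((M : ℝ) + r + 1) * (M + r + 2)) ^ 2 * cc M r ^ 2
      ≤ (4096 * ((M : ℝ) ^ 2 * (r : ℝ) ^ 4 + (M : ℝ) ^ 2 + (r : ℝ) ^ 8 + 1
      + (M : ℝ) ^ 2 * (r : ℝ) ^ 2)) / (M : ℝ) ^ 4 * cc M r ^ 2 := by
        have := hn.trans hn2
        gcongr
    _ = _ := by ring

lemma lim_G0 : Tendsto (fun M => N2 M (G0 M) / cn M) atTop (nhds (15 / 32)) := by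
  have h := lim_HH3.const_mul 4
  rw [show (4 : ℝ) * (15 / 128) = 15 / 32 by norm_num] at h
  refine h.congr' ?_
  filter_upwards [eventually_ge_atTop 10] with M hM
  have hM := cast_ten hM
  have hQ := (QQ_pos M).ne'
  have : N2 M (G0 M) = 4 / (M : ℝ) ^ 2 * HH 3 M := by
    unfold N2 G0 HH
    rw [Finset.mul_sum]
    refine Finset.sum_congr rfl fun r _ => ?_
    field_simp
    ring
  rw [this]
  unfold cn
  field_simp

lemma lim_G : Tendsto (fun M => N2 M (Gf M) / cn M) atTop (nhds (15 / 32)) := by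
  have h := N2_perturb G0 (fun M r => Gf M r - G0 M r) cn cn_nonneg _ lim_G0
    (small_of_le _ 32 (fun M => N2_nonneg _ _) e1_bound)
  refine h.congr fun M => ?_
  simp only [add_sub_cancel]

lemma lim_V (a : ℝ) (hb : |a - 1| < 1) :
    Tendsto (fun M => N2 M (fun r => (2 - a) * Vf a M r) / cn M) atTop (nhds (15 / 32)) := by
  have hD : Tendsto (fun M => N2 M (fun r => Vf a M (r + 1) - Vf a M r) / cn M) atTop (nhds 0) := by
    apply small_of_le _ (4096 / (1 - |a - 1|) ^ 2) (fun M => N2_nonneg _ _)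
    intro M hM
    have h1 : N2 M (fun r => Vf a M (r + 1) - Vf a M r)
        ≤ N2 M (fun r => Gf M (r + 1) - Gf M r) / (1 - |a - 1|) ^ 2 := by
      apply N2_shift M (a - 1) hb
      · rw [Vf_zero a M (M + 1) (by omega), Vf_zero a M (M + 1 + 1) (by omega)]; simp
      · intro r
        have := Vf_rec a M r (by omega)
        have := Vf_rec a M (r + 1) (by omega)
        linarith
    refine h1.trans ?_
    rw [div_mul_eq_mul_div]
    exact div_le_div_of_nonneg_right (DG_bound M hM) (sq_nonneg _)
  have hD' := N2_scale _ (fun _ => a - 1) cn (a - 1) 0 tendsto_const_nhds hD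
  rw [mul_zero] at hD'
  have h := N2_perturb Gf _ cn cn_nonneg _ lim_G hD'
  refine h.congr' ?_
  filter_upwards [eventually_ge_atTop 10] with M hM
  congr 2
  funext r
  have := Vf_rec a M r (by omega)
  linarith

lemma lim_W (a : ℝ) (hb : |a - 1| < 1) :
    Tendsto (fun M => N2 M (Wf a M) / cn M) atTop (nhds 0) := by
  apply small_of_le _ (8 / (1 - |a - 1|) ^ 2) (fun M => N2_nonneg _ _)
  intro M hM
  have h1 : N2 M (Wf a M) ≤ N2 M (Ew M) / (1 - |a - 1|) ^ 2 :=
    N2_shift M (a - 1) hb _ _ (Wf_zero a M (M + 1) (by omega)) (Wf_rec a M)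
  refine h1.trans ?_
  rw [div_mul_eq_mul_div]
  exact div_le_div_of_nonneg_right (E_bound M hM) (sq_nonneg _)

/-! ### Part 5: boundary values -/

lemma Ew_zero_pos (M : ℕ) : 0 < Ew M 0 := by
  rw [Ew_eq]
  have : 0 < cc M 0 := by
    unfold cc
    exact_mod_cast Nat.choose_pos (by omega)
  positivity

lemma cc_nonneg (M r : ℕ) : 0 ≤ cc M r := by unfold cc; positivity

lemma cc_le (M r : ℕ) : cc M r ≤ cc M 0 := by
  unfold cc
  have := Nat.choose_le_centralBinom (M + r) M
  rw [Nat.centralBinom_eq_two_mul_choose] at this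
  exact_mod_cast this

lemma Ew_ratio_le (M l : ℕ) : |Ew M l / Ew M 0| ≤ 2 * (l : ℝ) + 1 := by
  have h0 := Ew_zero_pos M
  have hl : 0 ≤ Ew M l := by
    rw [Ew_eq]; have := cc_nonneg M l; positivity
  rw [abs_of_nonneg (div_nonneg hl h0.le), div_le_iff₀ h0, Ew_eq, Ew_eq]
  have h1 := cc_le M l
  have h2 := cc_nonneg M l
  have h3 := cc_nonneg M 0
  calc (2 * (l : ℝ) + 1) / (M + l + 1) * cc M l
      ≤ (2 * (l : ℝ) + 1) / (M + 1) * cc M 0 := by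
        gcongr
        linarith [(Nat.cast_nonneg l : (0 : ℝ) ≤ l)]
    _ = _ := by push_cast; ring

lemma cc_ratio (l : ℕ) : Tendsto (fun M => cc M l / cc M 0) atTop (nhds 1) := by
  induction l with
  | zero =>
    refine tendsto_const_nhds.congr fun M => ?_
    rw [div_self]
    unfold cc
    exact_mod_cast (Nat.choose_pos (by omega)).ne'
  | succ l ih =>
    have h1 : Tendsto (fun M : ℕ => ((M : ℝ) - l) / (M + l + 1)) atTop (nhds 1) := by
      apply ratlim (fun x => (1 - l * x) / (1 + l * x + x))
      · exact ContinuousAt.div (by fun_prop) (by fun_prop) (by norm_num)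
      · norm_num
      intro M hM
      have hM := cast_ten hM
      have h5 : 1 + (l : ℝ) * (M : ℝ)⁻¹ + (M : ℝ)⁻¹ = (M + l + 1) / M := by field_simp
      have h6 : 1 - (l : ℝ) * (M : ℝ)⁻¹ = (M - l) / M := by field_simp
      rw [h5, h6]
      field_simp
    have h := h1.mul ih
    rw [mul_one] at h
    refine h.congr fun M => ?_
    have hcc : cc M (l + 1) = ((M : ℝ) - l) * cc M l / (M + l + 1) := by
      rw [eq_div_iff (by positivity)]; linear_combination cc_succ M l
    rw [hcc]; ring

lemma Ew_ratio (l : ℕ) : Tendsto (fun M => Ew M l / Ew M 0) atTop (nhds (2 * (l : ℝ) + 1)) := by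
  have h1 : Tendsto (fun M : ℕ => ((M : ℝ) + 1) / (M + l + 1)) atTop (nhds 1) := by
    apply ratlim (fun x => (1 + x) / (1 + l * x + x))
    · exact ContinuousAt.div (by fun_prop) (by fun_prop) (by norm_num)
    · norm_num
    intro M hM
    have hM := cast_ten hM
    have h5 : 1 + (l : ℝ) * (M : ℝ)⁻¹ + (M : ℝ)⁻¹ = (M + l + 1) / M := by field_simp
    rw [h5]
    field_simp
  have h := (h1.mul (cc_ratio l)).const_mul (2 * (l : ℝ) + 1)
  rw [mul_one, mul_one] at h
  refine h.congr fun M => ?_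
  have h0 : cc M 0 ≠ 0 := by
    unfold cc
    exact_mod_cast (Nat.choose_pos (by omega)).ne'
  rw [Ew_eq, Ew_eq]
  push_cast
  field_simp
  ring

lemma sum_of_rec (b : ℝ) (y g : ℕ → ℝ) (M : ℕ) (h0 : y M = 0)
    (hr : ∀ r, y r = g r + b * y (r + 1)) : y 0 = ∑ l ∈ Finset.range M, b ^ l * g l := by
  have h : ∀ n, y 0 = ∑ l ∈ Finset.range n, b ^ l * g l + b ^ n * y n := by
    intro n
    induction n with
    | zero => simp
    | succ n ih =>
      rw [ih, Finset.sum_range_succ, hr n]; ring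
  rw [h M, h0]; ring

lemma tannery (b : ℝ) (g : ℕ → ℝ) (y : ℕ → ℕ → ℝ)
    (hs : Summable fun l : ℕ => ‖b ^ l * g l * (2 * (l : ℝ) + 1)‖)
    (h0 : ∀ M, 1 ≤ M → y M (M + 1) = 0)
    (hr : ∀ M r, 1 ≤ M → y M r = g r * Ew M r + b * y M (r + 1)) :
    Tendsto (fun M => y M 0 / Ew M 0) atTop (nhds (∑' l : ℕ, b ^ l * g l * (2 * (l : ℝ) + 1))) := by
  have h := tendsto_tsum_of_dominated_convergence (𝓕 := (atTop : Filter ℕ))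
    (f := fun M l => b ^ l * g l * (Ew M l / Ew M 0))
    (g := fun l : ℕ => b ^ l * g l * (2 * (l : ℝ) + 1)) hs
    (fun l => (Ew_ratio l).const_mul _)
    (by
      filter_upwards with M l
      rw [norm_mul, norm_mul (b ^ l * g l)]
      gcongr
      rw [Real.norm_eq_abs, Real.norm_eq_abs]
      exact (Ew_ratio_le M l).trans (le_abs_self _))
  refine h.congr' ?_
  filter_upwards [eventually_ge_atTop 1] with M hM
  rw [sum_of_rec b (y M) (fun r => g r * Ew M r) (M + 1) (h0 M hM) (fun r => hr M r hM),
    Finset.sum_div]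
  rw [tsum_eq_sum (s := Finset.range (M + 1))]
  · exact Finset.sum_congr rfl fun l _ => by ring
  · intro l hl
    have : M < l := by
      by_contra hcon
      exact hl (Finset.mem_range.2 (by omega))
    rw [Ew_eq M l, cc_zero_of_lt M l this]; simp

lemma sum_pow (b : ℝ) (hb : |b| < 1) (k : ℕ) : Summable fun l : ℕ => (l : ℝ) ^ k * b ^ l := by
  exact summable_pow_mul_geometric_of_norm_lt_one k (by simpa using hb)

lemma W0_lim (a : ℝ) (hb : |a - 1| < 1) :
    Tendsto (fun M => Wf a M 0 / Ew M 0) atTop (nhds (a / (2 - a) ^ 2)) := by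
  have hs : Summable fun l : ℕ => (a - 1) ^ l * (1 : ℝ) * (2 * (l : ℝ) + 1) := by
    refine (((sum_pow (a - 1) hb 1).mul_left 2).add (sum_pow (a - 1) hb 0)).congr fun l => ?_
    ring
  have h := tannery (a - 1) (fun _ => 1) (Wf a) hs.norm
    (fun M _ => Wf_zero a M (M + 1) (by omega))
    (fun M r _ => by rw [one_mul]; exact Wf_rec a M r)
  have hv : ∑' l : ℕ, (a - 1) ^ l * (1 : ℝ) * (2 * (l : ℝ) + 1) = a / (2 - a) ^ 2 := by
    have h1 := (hasSum_coe_mul_geometric_of_norm_lt_one (r := a - 1) (by simpa using hb)).mul_left 2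
    have h2 := hasSum_geometric_of_norm_lt_one (ξ := a - 1) (by simpa using hb)
    have h3 := h1.add h2
    have h4 : (2 : ℝ) - a ≠ 0 := by
      have := (abs_lt.1 hb).2
      linarith
    have h5 : 2 * ((a - 1) / (1 - (a - 1)) ^ 2) + (1 - (a - 1))⁻¹ = a / (2 - a) ^ 2 := by
      rw [show 1 - (a - 1) = 2 - a by ring]
      field_simp
      ring
    rw [h5] at h3
    rw [← h3.tsum_eq]
    exact tsum_congr fun l => by ring
  rw [hv] at h
  exact h

lemma V0_lim (a : ℝ) (hb : |a - 1| < 1) :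
    ∃ v, Tendsto (fun M => Vf a M 0 / Ew M 0) atTop (nhds v) := by
  have hs : Summable fun l : ℕ => (a - 1) ^ l * ((l : ℝ) * (l + 1)) * (2 * (l : ℝ) + 1) := by
    refine ((((sum_pow (a - 1) hb 3).mul_left 2).add ((sum_pow (a - 1) hb 2).mul_left 3)).add
      (sum_pow (a - 1) hb 1)).congr fun l => ?_
    ring
  exact ⟨_, tannery (a - 1) (fun l => (l : ℝ) * (l + 1)) (Vf a) hs.norm
    (fun M _ => Vf_zero a M (M + 1) (by omega))
    (fun M r hM => Vf_rec a M r hM)⟩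

lemma lim_X (a : ℝ) (ha : 0 < a) (ha2 : a < 2) :
    Tendsto (fun M => N2 M (Xf a M) / Ew M 0 ^ 2 / cn M) atTop
      (nhds (a ^ 2 / (2 - a) ^ 6 * (15 / 32))) := by
  have hb : |a - 1| < 1 := by rw [abs_lt]; constructor <;> linarith
  have h2a : (2 : ℝ) - a ≠ 0 := by linarith
  obtain ⟨v, hv⟩ := V0_lim a hb
  have hW0 := W0_lim a hb
  have h1 := N2_scale _ (fun M => Wf a M 0 / Ew M 0 / (2 - a)) cn _ _ (hW0.div_const (2 - a))
    (lim_V a hb)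
  have h2 := N2_scale _ (fun M => -(Vf a M 0 / Ew M 0)) cn _ _ hv.neg (lim_W a hb)
  rw [mul_zero] at h2
  have h := N2_perturb _ _ cn cn_nonneg _ h1 h2
  rw [show (a / (2 - a) ^ 2 / (2 - a)) ^ 2 = a ^ 2 / (2 - a) ^ 6 by field_simp] at h
  refine h.congr fun M => ?_
  congr 1
  have h0 := (Ew_zero_pos M).ne'
  rw [div_eq_inv_mul (N2 M (Xf a M)), ← inv_pow, ← N2_mul]
  congr 1
  funext r
  unfold Xf
  field_simp
  ring

/-! ### Part 6: central binomial asymptotics and conclusion -/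

noncomputable def be (n : ℕ) : ℝ := (n.centralBinom : ℝ) * Real.sqrt n / 4 ^ n

lemma be_lim : Tendsto be atTop (nhds (1 / Real.sqrt Real.pi)) := by
  have h1 := Stirling.tendsto_stirlingSeq_sqrt_pi
  have h2 : Tendsto (fun n : ℕ => Stirling.stirlingSeq (2 * n)) atTop
      (nhds (Real.sqrt Real.pi)) :=
    h1.comp (tendsto_id.const_mul_atTop' (by norm_num : 0 < 2))
  have hpi : Real.sqrt Real.pi ≠ 0 := (Real.sqrt_pos.2 Real.pi_pos).ne'
  have h := h2.div (h1.pow 2) (pow_ne_zero 2 hpi)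
  rw [show Real.sqrt Real.pi / Real.sqrt Real.pi ^ 2 = 1 / Real.sqrt Real.pi by
    field_simp] at h
  refine h.congr' ?_
  filter_upwards [eventually_ge_atTop 1] with n hn
  have hn0 : (0 : ℝ) < n := by exact_mod_cast hn
  unfold be Stirling.stirlingSeq
  simp only [Pi.div_apply]
  have hcb : (n.centralBinom : ℝ) = ((2 * n).factorial : ℝ) / ((n.factorial : ℝ) ^ 2) := by
    rw [eq_div_iff (by positivity)]
    have := Nat.choose_mul_factorial_mul_factorial (show n ≤ 2 * n by omega)
    rw [Nat.centralBinom_eq_two_mul_choose, ← this, show 2 * n - n = n by omega]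
    push_cast; ring
  rw [hcb]
  have s1 : Real.sqrt (2 * ((2 * n : ℕ) : ℝ)) = 2 * Real.sqrt n := by
    rw [show 2 * ((2 * n : ℕ) : ℝ) = 2 ^ 2 * n by push_cast; ring, Real.sqrt_mul (by norm_num),
      Real.sqrt_sq (by norm_num)]
  have s2 : Real.sqrt (2 * (n : ℝ)) ^ 2 = 2 * n := Real.sq_sqrt (by positivity)
  have s3 : Real.sqrt (n : ℝ) ^ 2 = n := Real.sq_sqrt (by positivity)
  have s4 : (((2 * n : ℕ) : ℝ) / Real.exp 1) ^ (2 * n)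
      = 4 ^ n * (((n : ℝ) / Real.exp 1) ^ n) ^ 2 := by
    rw [← pow_mul, mul_comm n 2, pow_mul _ 2 n, pow_mul _ 2 n, ← mul_pow]
    congr 1
    push_cast
    ring
  rw [s1, s4]
  have hs : Real.sqrt (n : ℝ) ≠ 0 := (Real.sqrt_pos.2 hn0).ne'
  have he : ((n : ℝ) / Real.exp 1) ^ n ≠ 0 := by positivity
  generalize ((n : ℝ) / Real.exp 1) ^ n = z at he ⊢
  rw [div_pow, mul_pow (Real.sqrt (2 * (n : ℝ))), s2]
  field_simp
  linear_combination (-1 : ℝ) * s3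

/-- The elementary prefactor. -/
lemma lim_pref : Tendsto (fun M : ℕ => (1 / (2 * (M : ℝ) * (2 * M - 1))) ^ 2 * Ew M 0 ^ 2 * cn M
      * (4 * (M : ℝ) - 2) ^ ((13 : ℝ) / 2) / (4 ^ (4 * M) / 16)) atTop
    (nhds (4096 * Real.sqrt 2 / Real.pi ^ ((3 : ℝ) / 2))) := by
  have hb2 : Tendsto (fun M : ℕ => be (2 * M)) atTop (nhds (1 / Real.sqrt Real.pi)) :=
    be_lim.comp (tendsto_id.const_mul_atTop' (by norm_num : 0 < 2))
  have hr : Tendsto (fun M : ℕ => 16 * (4 * (M : ℝ) - 2) ^ 6 / ((M + 1) ^ 2 * (2 * M * (2 * M - 1)) ^ 2))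
      atTop (nhds 4096) := by
    apply ratlim (fun x => 16 * (4 - 2 * x) ^ 6 / ((1 + x) ^ 2 * (2 * (2 - x)) ^ 2))
    · exact ContinuousAt.div (by fun_prop) (by fun_prop) (by norm_num)
    · norm_num
    intro M hM
    have hM := cast_ten hM
    have h5 : 4 - 2 * (M : ℝ)⁻¹ = (4 * M - 2) / M := by field_simp
    have h6 : 1 + (M : ℝ)⁻¹ = (M + 1) / M := by field_simp
    have h7 : 2 - (M : ℝ)⁻¹ = (2 * M - 1) / M := by field_simp
    have h8 : 2 * (M : ℝ) - 1 ≠ 0 := by linarith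
    rw [h5, h6, h7]
    field_simp
  have hq : Tendsto (fun M : ℕ => Real.sqrt ((4 * (M : ℝ) - 2) / (2 * M))) atTop
      (nhds (Real.sqrt 2)) := by
    apply Tendsto.sqrt
    apply ratlim (fun x => (4 - 2 * x) / 2)
    · fun_prop
    · norm_num
    intro M hM
    have hM := cast_ten hM
    field_simp
  have h := (((be_lim.pow 2).mul hb2).mul hr).mul hq
  have hpi : 0 < Real.sqrt Real.pi := Real.sqrt_pos.2 Real.pi_pos
  have hp : Real.pi ^ ((3 : ℝ) / 2) = Real.sqrt Real.pi ^ 3 := by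
    rw [Real.sqrt_eq_rpow, ← Real.rpow_natCast, ← Real.rpow_mul Real.pi_pos.le]
    norm_num
  have hv : (1 / Real.sqrt Real.pi) ^ 2 * (1 / Real.sqrt Real.pi) * 4096 * Real.sqrt 2
      = 4096 * Real.sqrt 2 / Real.pi ^ ((3 : ℝ) / 2) := by
    rw [hp]
    field_simp
  rw [hv] at h
  refine h.congr' ?_
  filter_upwards [eventually_ge_atTop 10] with M hM
  have hM := cast_ten hM
  have hn : 0 < 4 * (M : ℝ) - 2 := by linarith
  have h21 : 2 * (M : ℝ) - 1 ≠ 0 := by linarith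
  have hE : Ew M 0 = (M.centralBinom : ℝ) / (M + 1) := by
    rw [Ew_eq]; unfold cc
    rw [Nat.centralBinom_eq_two_mul_choose]
    simp only [add_zero]
    push_cast; ring
  have hn13 : (4 * (M : ℝ) - 2) ^ ((13 : ℝ) / 2) = (4 * (M : ℝ) - 2) ^ 6 * Real.sqrt (4 * M - 2) := by
    rw [Real.sqrt_eq_rpow, ← Real.rpow_natCast, ← Real.rpow_add hn]
    norm_num
  rw [hE, hn13, Real.sqrt_div hn.le]
  unfold be cn QQ
  have s3 : Real.sqrt (M : ℝ) ^ 2 = M := Real.sq_sqrt (by linarith)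
  have e2 : ((2 * M : ℕ) : ℝ) = 2 * (M : ℝ) := by push_cast; ring
  have hs2 : Real.sqrt (2 * (M : ℝ)) ≠ 0 := (Real.sqrt_pos.2 (by linarith)).ne'
  have e4 : (4 : ℝ) ^ (4 * M) = (4 ^ M) ^ 4 := by rw [← pow_mul, mul_comm]
  have e5 : (4 : ℝ) ^ (2 * M) = (4 ^ M) ^ 2 := by rw [← pow_mul, mul_comm]
  rw [e2, e4, e5, div_pow, mul_pow, s3]
  have h4 : (4 : ℝ) ^ M ≠ 0 := by positivity
  generalize (4 : ℝ) ^ M = z at h4 ⊢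
  field_simp

/-- Asymptotics of `P^{G1}_{2n}(a,1)` for `0 < a < 2`, along `n ≡ 2 (mod 4)`. -/
theorem PG1_asymp_asmall_y1 (a : ℝ) (ha : 0 < a) (ha2 : a < 2) :
    Tendsto (fun j : ℕ =>
        PG1 (4 * j + 2) a 1 * ((4 * j + 2 : ℕ) : ℝ) ^ ((13 : ℝ) / 2)
          / (4 : ℝ) ^ (4 * j + 2))
      atTop (nhds (1920 * Real.sqrt 2 * a ^ 4 / (Real.pi ^ ((3 : ℝ) / 2) * (a - 2) ^ 6))) := by

  have h := (((lim_pref.mul (lim_X a ha ha2)).const_mul (a ^ 2)).comp (tendsto_add_atTop_nat 1))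
  have h2a : (2 : ℝ) - a ≠ 0 := by linarith
  have hv : a ^ 2 * (4096 * Real.sqrt 2 / Real.pi ^ ((3 : ℝ) / 2)
        * (a ^ 2 / (2 - a) ^ 6 * (15 / 32)))
      = 1920 * Real.sqrt 2 * a ^ 4 / (Real.pi ^ ((3 : ℝ) / 2) * (a - 2) ^ 6) := by
    rw [show (a - 2) ^ 6 = (2 - a) ^ 6 by ring]
    have hp : Real.pi ^ ((3 : ℝ) / 2) ≠ 0 := (Real.rpow_pos_of_pos Real.pi_pos _).ne'
    field_simp
    ring
  rw [hv] at h
  refine h.congr fun j => ?_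
  rw [PG1_eq]
  simp only [Function.comp_apply]
  have hE := (Ew_zero_pos (j + 1)).ne'
  have hc : cn (j + 1) ≠ 0 := by
    unfold cn
    have := (QQ_pos (j + 1)).ne'
    positivity
  have e1 : ((4 * j + 2 : ℕ) : ℝ) = 4 * ((j + 1 : ℕ) : ℝ) - 2 := by push_cast; ring
  have e2 : (4 : ℝ) ^ (4 * (j + 1)) / 16 = 4 ^ (4 * j + 2) := by
    rw [show 4 * (j + 1) = 4 * j + 2 + 2 by ring, pow_add]; norm_num
  rw [e1, e2]
  have e3 : ∑ r ∈ Finset.range (j + 1 + 1), (Xf a (j + 1) r) ^ 2 = N2 (j + 1) (Xf a (j + 1)) := rfl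
  rw [e3]
  have e4 : (a / (2 * ((j : ℝ) + 1) * (2 * (j + 1) - 1))) ^ 2
      = a ^ 2 * (1 / (2 * ((j + 1 : ℕ) : ℝ) * (2 * ((j + 1 : ℕ) : ℝ) - 1))) ^ 2 := by
    push_cast; ring
  rw [e4]
  generalize (1 / (2 * ((j + 1 : ℕ) : ℝ) * (2 * ((j + 1 : ℕ) : ℝ) - 1))) ^ 2 = u
  generalize (4 * ((j + 1 : ℕ) : ℝ) - 2) ^ ((13 : ℝ) / 2) = w
  field_simp
end
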